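/- Let G be a group generated by a finite set A, with word metric d_A. Then G is virtually free if and only if there exists ε ≥ 0 such that for every discrete geodesic γ from g to h and every discrete path γ' from g to h in G, every vertex of γ lies within d_A-distance ε of some vertex of γ'. -/

import Mathlib

/-- The word metric associated with a generating set `A` of a group `G`:
`wordDist A g h` is the least `n` such that `g⁻¹h` is a product of `n` elements
of `A ∪ A⁻¹`. -/
noncomputable def wordDist {G : Type*} [Group G] (A : Set G) (g h : G) : ℕ :=
  sInf { n : ℕ | ∃ l : List G, l.length = n ∧ (∀ x ∈ l, x ∈ A ∪ A⁻¹) ∧ l.prod = g⁻¹ * h }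

/-- A group is virtually free if it has a free subgroup of finite index. -/
def VirtuallyFree (G : Type*) [Group G] : Prop :=
  ∃ H : Subgroup G, H.FiniteIndex ∧ IsFreeGroup H
/-- `γ 0, γ 1, …, γ m` is a discrete geodesic for the word metric of `A`:
`d_A(γ i, γ j) = |i − j|` for all `i, j ≤ m`. -/
def IsDiscGeodesic {G : Type*} [Group G] (A : Set G) (γ : ℕ → G) (m : ℕ) : Prop :=
  ∀ i ≤ m, ∀ j ≤ m, (wordDist A (γ i) (γ j) : ℤ) = |(i : ℤ) - (j : ℤ)|

/-- `γ 0, γ 1, …, γ m` is a discrete path for the word metric of `A`: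
consecutive vertices are at distance at most `1`. -/
def IsDiscPath {G : Type*} [Group G] (A : Set G) (γ : ℕ → G) (m : ℕ) : Prop :=
  ∀ i < m, wordDist A (γ i) (γ (i + 1)) ≤ 1

section FreePermutationActions

universe u

theorem exists_equiv_prod_of_free {H : Type*} {X : Type u} [Group H] (φ : H →* Equiv.Perm X)
    (hφ : ∀ h x, φ h x = x → h = 1) :
    ∃ (Ω : Type u) (e : X ≃ Ω × H), ∀ h x, e (φ h x) = ((e x).1, h * (e x).2) := by
  let _ : MulAction H X := MulAction.compHom X φ
  have hs : ∀ (h : H) (x : X), h • x = φ h x := fun _ _ => rfl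
  let Ω := MulAction.orbitRel.Quotient H X
  have hex : ∀ x : X, ∃ h : H, h • (Quotient.out (Quotient.mk _ x : Ω)) = x := fun x => by
    have : (Quotient.out (Quotient.mk _ x : Ω)) ∈ MulAction.orbit H x :=
      MulAction.orbitRel_apply.1 (Quotient.mk_out (s := MulAction.orbitRel H X) x)
    obtain ⟨h, hh⟩ := this
    exact ⟨h⁻¹, by rw [← hh]; simp⟩
  choose c hc using hex
  have hfree : ∀ (h k : H) (x : X), h • x = k • x → h = k := fun h k x hx => by
    have : (k⁻¹ * h) • x = x := by rw [mul_smul, hx, inv_smul_smul]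
    exact (inv_mul_eq_one.1 (hφ _ _ this)).symm
  have hmk : ∀ (h : H) (x : X), (Quotient.mk _ (h • x) : Ω) = Quotient.mk _ x := fun h x =>
    Quotient.sound (s := MulAction.orbitRel H X) (MulAction.orbitRel_apply.2 ⟨h, rfl⟩)
  have hcs : ∀ (h : H) (x : X), c (h • x) = h * c x := fun h x => by
    apply hfree _ _ (Quotient.out (Quotient.mk _ x : Ω))
    rw [mul_smul, hc x]
    have := hc (h • x)
    rwa [hmk] at this
  refine ⟨Ω, ⟨fun x => (Quotient.mk _ x, c x), fun p => p.2 • Quotient.out p.1, hc, ?_⟩, ?_⟩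
  · rintro ⟨ω, h⟩
    have h1 : (Quotient.mk _ (h • Quotient.out ω) : Ω) = ω := by
      rw [hmk]; exact Quotient.out_eq ω
    refine Prod.ext h1 ?_
    apply hfree _ _ (Quotient.out ω)
    have := hc (h • Quotient.out ω)
    rwa [h1] at this
  · intro h x
    exact Prod.ext (hmk h x) (hcs h x)

/-- Two free actions of a group on the same finite set are conjugate. -/
theorem exists_perm_conj_of_free {H X : Type*} [Group H] [Finite X] (φ ψ : H →* Equiv.Perm X)
    (hφ : ∀ h x, φ h x = x → h = 1) (hψ : ∀ h x, ψ h x = x → h = 1) :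
    ∃ τ : Equiv.Perm X, ∀ h, τ * φ h = ψ h * τ := by
  rcases isEmpty_or_nonempty X with hX | ⟨⟨x₀⟩⟩
  · exact ⟨1, fun h => Subsingleton.elim _ _⟩
  obtain ⟨Ω₁, e₁, h₁⟩ := exists_equiv_prod_of_free φ hφ
  obtain ⟨Ω₂, e₂, h₂⟩ := exists_equiv_prod_of_free ψ hψ
  have : Finite H := Finite.of_injective (fun h => e₁.symm ((e₁ x₀).1, h)) fun a b hab => by
    simpa using hab
  have : Finite Ω₁ := Finite.of_injective (fun o => e₁.symm (o, 1)) fun a b hab => by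
    simpa using hab
  have : Finite Ω₂ := Finite.of_injective (fun o => e₂.symm (o, 1)) fun a b hab => by
    simpa using hab
  have hcard : Nat.card Ω₁ = Nat.card Ω₂ := by
    have := (Nat.card_congr e₁).symm.trans (Nat.card_congr e₂)
    rw [Nat.card_prod, Nat.card_prod] at this
    exact Nat.eq_of_mul_eq_mul_right Nat.card_pos this
  obtain ⟨e⟩ := Finite.card_eq.1 hcard
  refine ⟨e₁.trans ((e.prodCongr (Equiv.refl H)).trans e₂.symm), fun h => Equiv.ext fun x => ?_⟩
  apply e₂.injective
  simp [h₁, h₂]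

theorem exists_free_perm_action {S : Type*} [Group S] {n : ℕ} (hn : 0 < n)
    (hS : Nat.card S ∣ n) :
    ∃ ψ : S →* Equiv.Perm (Fin n), ∀ s x, ψ s x = x → s = 1 := by
  obtain ⟨m, rfl⟩ := hS
  have : Finite S := Nat.finite_of_card_ne_zero (by rintro h; simp [h] at hn)
  obtain ⟨e⟩ : Nonempty (S × Fin m ≃ Fin (Nat.card S * m)) :=
    Finite.card_eq.1 (by simp)
  refine ⟨MonoidHom.mk' (fun s => e.permCongr ((Equiv.mulLeft s).prodCongr (Equiv.refl _))) ?_, ?_⟩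
  · intro a b
    ext x
    simp [Equiv.permCongr_apply, Prod.map]
  · intro s x h
    have h2 := congrArg e.symm h
    simp only [MonoidHom.mk'_apply, Equiv.permCongr_apply, Equiv.symm_apply_apply] at h2
    have h3 := congrArg Prod.fst h2
    simpa using h3

end FreePermutationActions

section FreeCocycles

variable {G V : Type*} [Group G] [MulAction G V]

/-- If the orders of all stabilizers divide `n`, there is a permutation cocycle over the action
whose restriction to every stabilizer is a free action. -/
theorem exists_free_cocycle {n : ℕ} (hn : 0 < n)
    (hstab : ∀ v : V, Nat.card (MulAction.stabilizer G v) ∣ n) :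
    ∃ α : G → V → Equiv.Perm (Fin n),
      (∀ g h v, α (g * h) v = α g (h • v) * α h v) ∧
      ∀ g v x, g • v = v → α g v x = x → g = 1 := by
  let Ω := MulAction.orbitRel.Quotient G V
  let rep : V → V := fun v => Quotient.out (Quotient.mk _ v : Ω)
  have hrep : ∀ (g : G) v, rep (g • v) = rep v := fun g v => by
    have : (Quotient.mk _ (g • v) : Ω) = Quotient.mk _ v :=
      Quotient.sound (s := MulAction.orbitRel G V) (MulAction.orbitRel_apply.2 ⟨g, rfl⟩)
    simp only [rep, this]
  have hex : ∀ v : V, ∃ g : G, g • rep v = v := fun v => by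
    have : rep v ∈ MulAction.orbit G v :=
      MulAction.orbitRel_apply.1 (Quotient.mk_out (s := MulAction.orbitRel G V) v)
    obtain ⟨h, hh⟩ := this
    exact ⟨h⁻¹, by rw [← hh]; simp⟩
  choose σ hσ using hex
  choose ψ hψ using fun v : V => exists_free_perm_action hn (hstab v)
  have hmem : ∀ (g : G) (v : V),
      (σ (g • v))⁻¹ * g * σ v ∈ MulAction.stabilizer G (rep v) := fun g v => by
    rw [MulAction.mem_stabilizer_iff, mul_smul, mul_smul, hσ, inv_smul_eq_iff]
    conv_rhs => rw [← hrep g v, hσ]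
  have key : ∀ (u w : V) (h : u = w) (s : MulAction.stabilizer G u)
      (t : MulAction.stabilizer G w), (s : G) = t → ψ u s = ψ w t := by
    rintro u _ rfl s t hst
    rw [Subtype.ext hst]
  refine ⟨fun g v => ψ (rep v) ⟨_, hmem g v⟩, ?_, ?_⟩
  · intro g h v
    have h1 : ψ (rep (h • v)) ⟨_, hmem g (h • v)⟩ = ψ (rep v) ⟨(σ (g • h • v))⁻¹ * g * σ (h • v),
        by have := hmem g (h • v); rwa [hrep] at this⟩ :=
      key _ _ (hrep h v) _ _ rfl
    simp only []
    rw [h1, ← map_mul]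
    congr 1
    apply Subtype.ext
    simp [mul_smul, mul_assoc]
  · intro g v x hg hx
    have := hψ _ _ _ hx
    have h2 := congrArg Subtype.val this
    simp only [Subgroup.coe_one, hg] at h2
    have h3 : g = σ v * ((σ v)⁻¹ * g * σ v) * (σ v)⁻¹ := by group
    rw [h3, h2]; simp

/-- Over any invariant family of pairs, a free permutation cocycle can be transported
equivariantly from the first to the second entry. -/
theorem exists_equivariant_transport {X : Type*} [Finite X] {α : G → V → Equiv.Perm X}
    (hmul : ∀ g h v, α (g * h) v = α g (h • v) * α h v)
    (hfree : ∀ g v x, g • v = v → α g v x = x → g = 1) :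
    ∃ τ : V → V → Equiv.Perm X,
      ∀ g u v, τ (g • u) (g • v) * α g u = α g v * τ u v := by
  let Ω := MulAction.orbitRel.Quotient G (V × V)
  let rep : V × V → V × V := fun v => Quotient.out (Quotient.mk _ v : Ω)
  have hrep : ∀ (g : G) v, rep (g • v) = rep v := fun g v => by
    have : (Quotient.mk _ (g • v) : Ω) = Quotient.mk _ v :=
      Quotient.sound (s := MulAction.orbitRel G (V × V)) (MulAction.orbitRel_apply.2 ⟨g, rfl⟩)
    simp only [rep, this]
  have hex : ∀ v : V × V, ∃ g : G, g • rep v = v := fun v => by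
    have : rep v ∈ MulAction.orbit G v :=
      MulAction.orbitRel_apply.1 (Quotient.mk_out (s := MulAction.orbitRel G (V × V)) v)
    obtain ⟨h, hh⟩ := this
    exact ⟨h⁻¹, by rw [← hh]; simp⟩
  choose σ hσ using hex
  have hone : ∀ v, α 1 v = 1 := fun v => by
    have := hmul 1 1 v
    rw [one_smul, one_mul] at this
    exact (left_eq_mul.1 this)
  have hτ : ∀ p : V × V, ∃ τ : Equiv.Perm X, ∀ g : G, g • p = p →
      τ * α g p.1 = α g p.2 * τ := fun p => by
    have h1 : ∀ g : MulAction.stabilizer G p, (g : G) • p.1 = p.1 := fun g =>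
      congrArg Prod.fst g.2
    have h2 : ∀ g : MulAction.stabilizer G p, (g : G) • p.2 = p.2 := fun g =>
      congrArg Prod.snd g.2
    obtain ⟨τ, hτ⟩ := exists_perm_conj_of_free (H := MulAction.stabilizer G p)
      (MonoidHom.mk' (fun g => α g p.1) fun g h => by simp [hmul, h1])
      (MonoidHom.mk' (fun g => α g p.2) fun g h => by simp [hmul, h2])
      (fun g x hx => Subtype.ext (hfree _ _ x (h1 g) hx))
      (fun g x hx => Subtype.ext (hfree _ _ x (h2 g) hx))
    exact ⟨τ, fun g hg => hτ ⟨g, hg⟩⟩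
  choose τ hτ using hτ
  refine ⟨fun u v => α (σ (u, v)) (rep (u, v)).2 * τ (rep (u, v)) *
    (α (σ (u, v)) (rep (u, v)).1)⁻¹, fun g u v => ?_⟩
  have hgp : (g • u, g • v) = g • (u, v) := rfl
  simp only [hgp, hrep]
  set p := (u, v)
  set k := σ p
  set k' := σ (g • p)
  set p₀ := rep p
  have hk : k • p₀ = p := hσ p
  have hk' : k' • p₀ = g • p := by have := hσ (g • p); rwa [hrep] at this
  have hh : (k'⁻¹ * g * k) • p₀ = p₀ := by
    rw [mul_smul, mul_smul, hk, inv_smul_eq_iff, hk']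
  have hc := hτ p₀ _ hh
  have hku : k • p₀.1 = u := congrArg Prod.fst hk
  have hkv : k • p₀.2 = v := congrArg Prod.snd hk
  have hh1 : (k'⁻¹ * g * k) • p₀.1 = p₀.1 := congrArg Prod.fst hh
  have hh2 : (k'⁻¹ * g * k) • p₀.2 = p₀.2 := congrArg Prod.snd hh
  have m1 : α k' p₀.1 * α (k'⁻¹ * g * k) p₀.1 = α g u * α k p₀.1 := by
    have a := hmul k' (k'⁻¹ * g * k) p₀.1
    have b := hmul g k p₀.1
    rw [hh1] at a
    rw [hku] at b
    rw [← a, ← b]; congr 1; group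
  have m2 : α k' p₀.2 * α (k'⁻¹ * g * k) p₀.2 = α g v * α k p₀.2 := by
    have a := hmul k' (k'⁻¹ * g * k) p₀.2
    have b := hmul g k p₀.2
    rw [hh2] at a
    rw [hkv] at b
    rw [← a, ← b]; congr 1; group
  have m1' : (α k' p₀.1)⁻¹ * α g u = α (k'⁻¹ * g * k) p₀.1 * (α k p₀.1)⁻¹ := by
    rw [inv_mul_eq_iff_eq_mul, ← mul_assoc, eq_mul_inv_iff_mul_eq, m1]
  calc α k' p₀.2 * τ p₀ * (α k' p₀.1)⁻¹ * α g u
      = α k' p₀.2 * (τ p₀ * α (k'⁻¹ * g * k) p₀.1) * (α k p₀.1)⁻¹ := by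
        rw [mul_assoc, m1']; simp only [mul_assoc]
    _ = α g v * (α k p₀.2 * τ p₀ * (α k p₀.1)⁻¹) := by
        rw [hc, ← mul_assoc, m2]; simp only [mul_assoc]

end FreeCocycles

section ParentTrees

/-- A rooted tree, encoded by its parent function and the distance to the root. -/
structure ParentTree (V : Type*) where
  root : V
  parent : V → V
  depth : V → ℕ
  depth_root : depth root = 0
  depth_eq : ∀ v, v ≠ root → depth v = depth (parent v) + 1

namespace ParentTree

variable {G V : Type*} (T : ParentTree V)

/-- Adjacency in a rooted tree. -/
def Adj (u v : V) : Prop :=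
  (u ≠ T.root ∧ v = T.parent u) ∨ (v ≠ T.root ∧ u = T.parent v)

variable {T}

theorem adj_parent {v : V} (hv : v ≠ T.root) : T.Adj (T.parent v) v := Or.inr ⟨hv, rfl⟩

theorem induct {P : V → Prop} (h0 : P T.root) (h1 : ∀ v, v ≠ T.root → P (T.parent v) → P v)
    (v : V) : P v := by
  induction hn : T.depth v using Nat.strong_induction_on generalizing v with
  | _ n ih =>
    by_cases hv : v = T.root
    · rwa [hv]
    · exact h1 v hv (ih _ (by have := T.depth_eq v hv; lia) _ rfl)

theorem exists_fold (T : ParentTree V) {X : Type*} (x₀ : X) (s : V → X → X) :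
    ∃ F : V → X, F T.root = x₀ ∧ ∀ v, v ≠ T.root → F v = s v (F (T.parent v)) := by
  classical
  let F' : ℕ → V → X := fun n => Nat.rec (fun _ => x₀) (fun _ F v => s v (F (T.parent v))) n
  refine ⟨fun v => F' (T.depth v) v, by simp [T.depth_root, F'], fun v hv => ?_⟩
  simp only [T.depth_eq v hv, F']

theorem even_depth_of_adj {u v : V} (h : T.Adj u v) : Even (T.depth v) ↔ ¬ Even (T.depth u) := by
  rcases h with ⟨hu, rfl⟩ | ⟨hv, rfl⟩
  · rw [T.depth_eq u hu, Nat.even_add_one, not_not]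
  · rw [T.depth_eq v hv, Nat.even_add_one]

theorem eq_of_parent {X : Type*} {c : V → X} (h : ∀ v, v ≠ T.root → c v = c (T.parent v)) (v : V) :
    c v = c T.root :=
  induct (T := T) (P := fun v => c v = c T.root) rfl (fun v hv ih => (h v hv).trans ih) v

variable [Group G] [MulAction G V]

/-- A group acting on a rooted tree, preserving the bipartition, with stabilizers of
bounded order, has a finite index subgroup that acts freely. -/
theorem exists_finiteIndex_free (hadj : ∀ (g : G) u v, T.Adj u v → T.Adj (g • u) (g • v))
    (hpar : ∀ (g : G) v, Even (T.depth (g • v)) ↔ Even (T.depth v)) {n : ℕ} (hn : 0 < n)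
    (hstab : ∀ v : V, Nat.card (MulAction.stabilizer G v) ∣ n) :
    ∃ K : Subgroup G, K.FiniteIndex ∧ ∀ k ∈ K, ∀ v : V, k • v = v → k = 1 := by
  classical
  obtain ⟨α, hmul, hfree⟩ := exists_free_cocycle hn hstab
  obtain ⟨τ, hτ⟩ := exists_equivariant_transport hmul hfree
  let σ : V → V → Equiv.Perm (Fin n) := fun u v =>
    if Even (T.depth u) then τ u v else (τ v u)⁻¹
  have hσ : ∀ g u v, σ (g • u) (g • v) * α g u = α g v * σ u v := by
    intro g u v
    simp only [σ, hpar]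
    split_ifs
    · exact hτ g u v
    · have := hτ g v u
      rw [inv_mul_eq_iff_eq_mul, ← mul_assoc, this]; simp [mul_assoc]
  have hσinv : ∀ u v, T.Adj u v → σ v u = (σ u v)⁻¹ := by
    intro u v h
    have := even_depth_of_adj h
    by_cases hu : Even (T.depth u) <;> simp [σ, hu, this]
  obtain ⟨F, hF0, hF1⟩ := T.exists_fold (1 : Equiv.Perm (Fin n))
    (fun v x => x * σ v (T.parent v))
  have hF : ∀ u v, T.Adj u v → F v = F u * σ v u := by
    intro u v h
    rcases id h with ⟨hu, rfl⟩ | ⟨hv, rfl⟩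
    · rw [hF1 u hu, hσinv _ _ h]; simp
    · exact hF1 v hv
  have hρ : ∀ (g : G) v, F (g • v) * α g v * (F v)⁻¹ =
      F (g • T.root) * α g T.root * (F T.root)⁻¹ := fun g =>
    eq_of_parent (T := T) (c := fun v => F (g • v) * α g v * (F v)⁻¹) fun v hv => by
      have h1 := adj_parent hv
      have h2 := hadj g _ _ h1
      have h3 := hσ g v (T.parent v)
      simp only [hF _ _ h1, hF _ _ h2]
      rw [mul_assoc (F _) (σ _ _), h3]; simp [mul_assoc]
  let ρ : G →* Equiv.Perm (Fin n) :=
    MonoidHom.mk' (fun g => F (g • T.root) * α g T.root * (F T.root)⁻¹) fun g h => by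
      rw [← hρ g (h • T.root), hmul, mul_smul]; simp [mul_assoc]
  refine ⟨ρ.ker, Subgroup.finiteIndex_ker ρ, fun k hk v hv => ?_⟩
  have h1 : F (k • v) * α k v * (F v)⁻¹ = 1 := (hρ k v).trans hk
  rw [hv, mul_inv_eq_one] at h1
  exact hfree k v ⟨0, hn⟩ hv (by rw [mul_eq_left.1 h1]; rfl)

/-- A group acting freely on a rooted tree, preserving the bipartition, is free. -/
theorem isFreeGroup_of_free (hadj : ∀ (g : G) u v, T.Adj u v → T.Adj (g • u) (g • v))
    (hpar : ∀ (g : G) v, Even (T.depth (g • v)) ↔ Even (T.depth v))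
    (hfree : ∀ (g : G) (v : V), g • v = v → g = 1) : IsFreeGroup G := by
  classical
  let S := MulAction.orbitRel.Quotient G (V × V)
  let orb : V → V → S := fun u v => Quotient.mk _ (u, v)
  have horb : ∀ {u v u' v'}, orb u v = orb u' v' ↔ ∃ g : G, g • u' = u ∧ g • v' = v := by
    intro u v u' v'
    refine Quotient.eq.trans (MulAction.orbitRel_apply.trans ?_)
    simp [MulAction.mem_orbit_iff]
  have horbg : ∀ (g : G) u v, orb (g • u) (g • v) = orb u v := fun g u v => horb.2 ⟨g, rfl, rfl⟩
  let lab : V → V → S × Bool := fun u v =>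
    if Even (T.depth u) then (orb u v, true) else (orb v u, false)
  have hlabg : ∀ (g : G) u v, lab (g • u) (g • v) = lab u v := by
    intro g u v
    simp only [lab, hpar, horbg]
  have hlabinv : ∀ u v, T.Adj u v →
      FreeGroup.mk [lab v u] = (FreeGroup.mk [lab u v])⁻¹ := by
    intro u v h
    have := even_depth_of_adj h
    by_cases hu : Even (T.depth u) <;> simp [lab, hu, this, FreeGroup.invRev]
  obtain ⟨L, hL0, hL1⟩ := T.exists_fold ([] : List (S × Bool))
    (fun v x => x ++ [lab (T.parent v) v])
  have hL : ∀ u v, T.Adj u v →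
      FreeGroup.mk (L v) = FreeGroup.mk (L u) * FreeGroup.mk [lab u v] := by
    intro u v h
    rcases id h with ⟨hu, rfl⟩ | ⟨hv, rfl⟩
    · rw [hL1 u hu, ← FreeGroup.mul_mk, hlabinv _ _ h, inv_mul_cancel_right]
    · rw [hL1 v hv, ← FreeGroup.mul_mk]
  have hρ : ∀ (g : G) v, FreeGroup.mk (L (g • v)) * (FreeGroup.mk (L v))⁻¹ =
      FreeGroup.mk (L (g • T.root)) * (FreeGroup.mk (L T.root))⁻¹ := fun g =>
    eq_of_parent (T := T) (c := fun v => FreeGroup.mk (L (g • v)) * (FreeGroup.mk (L v))⁻¹)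
      fun v hv => by
        have h1 := adj_parent hv
        have h2 := hadj g _ _ h1
        simp only [hL _ _ h1, hL _ _ h2, hlabg]
        simp only [mul_inv_rev, mul_assoc, mul_inv_cancel_left]
  have hone : FreeGroup.mk (L T.root) = 1 := by rw [hL0]; rfl
  let ρ : G →* FreeGroup S :=
    MonoidHom.mk' (fun g => FreeGroup.mk (L (g • T.root))) fun g h => by
      have := hρ g (h • T.root)
      rw [hone, inv_one, mul_one, mul_inv_eq_iff_eq_mul] at this
      rw [mul_smul, this]
  have hred : ∀ v, FreeGroup.IsReduced (L v) := by
    refine fun v => induct (T := T) (P := fun v => FreeGroup.IsReduced (L v)) ?_ ?_ v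
    · rw [hL0]; exact FreeGroup.IsReduced.nil
    · intro v hv ih
      rw [hL1 v hv]
      refine List.isChain_append.2 ⟨ih, List.isChain_singleton _, ?_⟩
      intro x hx y hy
      obtain rfl : lab (T.parent v) v = y := by simpa using hy
      by_cases hu : T.parent v = T.root
      · rw [hu, hL0] at hx; simp at hx
      rw [hL1 _ hu] at hx
      obtain rfl : lab (T.parent (T.parent v)) (T.parent v) = x := by simpa using hx
      have h1 := even_depth_of_adj (adj_parent hu)
      have d1 := T.depth_eq v hv
      have d2 := T.depth_eq _ hu
      intro heq
      exfalso
      have key : ∀ w : V, (∃ g : G, g • T.parent v = T.parent v ∧ g • v = w) → w = v := by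
        rintro w ⟨g, hg, rfl⟩
        rw [hfree g _ hg, one_smul]
      have : T.parent (T.parent v) = v := by
        by_cases hw : Even (T.depth (T.parent (T.parent v))) <;>
        · simp only [lab, h1, hw, not_true, not_false_eq_true, if_true, if_false] at heq
          obtain ⟨g, hg1, hg2⟩ := horb.1 heq
          exact key _ ⟨g, by assumption, by assumption⟩
      rw [this] at d2
      lia
  have hinj : Function.Injective ρ := by
    rw [injective_iff_map_eq_one]
    intro g hg
    have h1 : FreeGroup.mk (L (g • T.root)) = FreeGroup.mk [] := hg
    have h2 := congrArg FreeGroup.toWord h1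
    rw [FreeGroup.toWord_mk, FreeGroup.toWord_mk, (hred _).reduce_eq] at h2
    have h3 : L (g • T.root) = [] := h2
    apply hfree g T.root
    by_contra hne
    rw [hL1 _ hne] at h3
    simp at h3
  exact IsFreeGroup.ofMulEquiv (MonoidHom.ofInjective hinj).symm

theorem even_depth_smul (hadj : ∀ (g : G) u v, T.Adj u v → T.Adj (g • u) (g • v)) (g : G) (v : V) :
    Even (T.depth (g • v)) ↔ (Even (T.depth v) ↔ Even (T.depth (g • T.root))) := by
  refine induct (T := T) (P := fun v => Even (T.depth (g • v)) ↔
    (Even (T.depth v) ↔ Even (T.depth (g • T.root)))) ?_ ?_ v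
  · simp [T.depth_root]
  · intro v hv ih
    have h1 := adj_parent hv
    rw [even_depth_of_adj h1, even_depth_of_adj (hadj g _ _ h1), ih]
    tauto

end ParentTree

theorem VirtuallyFree.of_finiteIndex {G : Type*} [Group G] {H : Subgroup G} (hH : H.FiniteIndex)
    (h : VirtuallyFree H) : VirtuallyFree G := by
  obtain ⟨K, hK, hfree⟩ := h
  refine ⟨K.map H.subtype, ?_, ?_⟩
  · exact ⟨by
      rw [Subgroup.index_map_subtype]
      exact mul_ne_zero hK.index_ne_zero hH.index_ne_zero⟩
  · exact IsFreeGroup.ofMulEquiv (K.equivMapOfInjective H.subtype H.subtype_injective)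

/-- A group acting on a rooted tree with stabilizers of bounded order is virtually free. -/
theorem ParentTree.virtuallyFree {G V : Type*} [Group G] [MulAction G V] (T : ParentTree V)
    (hadj : ∀ (g : G) u v, T.Adj u v → T.Adj (g • u) (g • v)) {n : ℕ} (hn : 0 < n)
    (hstab : ∀ v : V, Nat.card (MulAction.stabilizer G v) ∣ n) : VirtuallyFree G := by
  classical
  let ρ : G →* Multiplicative (ZMod 2) :=
    MonoidHom.mk' (fun g => Multiplicative.ofAdd (T.depth (g • T.root) : ZMod 2)) fun g h => by
      rw [mul_smul, ← ofAdd_add]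
      congr 1
      have := even_depth_smul (T := T) hadj g (h • T.root)
      rw [← Nat.cast_add, ZMod.natCast_eq_natCast_iff, Nat.ModEq]
      have h2 : Even (T.depth (g • T.root) + T.depth (h • T.root)) ↔
        Even (T.depth (g • h • T.root)) := by rw [this, Nat.even_add, iff_comm (a := Even _)]
      rw [Nat.even_iff, Nat.even_iff] at h2
      lia
  have hker : ∀ g ∈ ρ.ker, ∀ v : V, Even (T.depth (g • v)) ↔ Even (T.depth v) := by
    intro g hg v
    have h1 : (T.depth (g • T.root) : ZMod 2) = 0 := hg
    rw [ZMod.natCast_eq_zero_iff_even] at h1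
    rw [even_depth_smul hadj]
    simp [h1]
  refine VirtuallyFree.of_finiteIndex (Subgroup.finiteIndex_ker ρ) ?_
  obtain ⟨K, hK, hfree⟩ := exists_finiteIndex_free (G := ρ.ker) (T := T)
    (fun g u v h => hadj g u v h) (fun g v => hker g g.2 v) hn fun v => by
      refine dvd_trans ?_ (hstab v)
      let f : MulAction.stabilizer ρ.ker v →* MulAction.stabilizer G v :=
        MonoidHom.mk' (fun k => ⟨(k : ρ.ker), k.2⟩) fun _ _ => rfl
      exact Subgroup.card_dvd_of_injective f fun a b hab =>
        Subtype.ext (Subtype.ext (congrArg (fun x : MulAction.stabilizer G v => (x : G)) hab))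
  exact ⟨K, hK, isFreeGroup_of_free (G := K) (T := T) (fun g u v h => hadj g u v h)
    (fun g v => hker g g.1.2 v) fun g v h => Subtype.ext (hfree g g.2 v h)⟩

end ParentTrees

section WordMetric

variable {G : Type*} [Group G] {A : Set G}

theorem wordDist_le {g h : G} (l : List G) (hl : ∀ x ∈ l, x ∈ A ∪ A⁻¹)
    (hp : l.prod = g⁻¹ * h) : wordDist A g h ≤ l.length :=
  Nat.sInf_le ⟨l, rfl, hl, hp⟩

theorem exists_word (hgen : Subgroup.closure A = ⊤) (g h : G) :
    ∃ l : List G, l.length = wordDist A g h ∧ (∀ x ∈ l, x ∈ A ∪ A⁻¹) ∧ l.prod = g⁻¹ * h := by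
  have hmem : g⁻¹ * h ∈ (Subgroup.closure A).toSubmonoid := by rw [hgen]; trivial
  rw [Subgroup.closure_toSubmonoid] at hmem
  obtain ⟨l, hl, hp⟩ := Submonoid.exists_list_of_mem_closure hmem
  exact Nat.sInf_mem
    (s := {n : ℕ | ∃ l : List G, l.length = n ∧ (∀ x ∈ l, x ∈ A ∪ A⁻¹) ∧ l.prod = g⁻¹ * h})
    ⟨_, l, rfl, hl, hp⟩

theorem inv_mem_gens {s : G} (hs : s ∈ A ∪ A⁻¹) : s⁻¹ ∈ A ∪ A⁻¹ := by
  rcases hs with hs | hs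
  · right; simpa using hs
  · left; exact hs

@[simp] theorem wordDist_self (g : G) : wordDist A g g = 0 :=
  Nat.le_zero.1 (wordDist_le [] (by simp) (by simp))

@[simp] theorem wordDist_mul_left (k g h : G) : wordDist A (k * g) (k * h) = wordDist A g h := by
  simp [wordDist, mul_assoc]

theorem wordDist_mul_gen_le {s : G} (hs : s ∈ A ∪ A⁻¹) (g : G) : wordDist A g (g * s) ≤ 1 :=
  wordDist_le [s] (by simpa using hs) (by simp)

theorem IsDiscGeodesic.wordDist_eq {γ : ℕ → G} {m i j : ℕ} (hγ : IsDiscGeodesic A γ m)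
    (hij : i ≤ j) (hj : j ≤ m) : wordDist A (γ i) (γ j) = j - i := by
  have := hγ i (hij.trans hj) j hj
  rw [abs_of_nonpos (by lia)] at this
  lia

theorem wordDist_triangle (hgen : Subgroup.closure A = ⊤)
    (g h k : G) : wordDist A g k ≤ wordDist A g h + wordDist A h k := by
  obtain ⟨l, hl, hlA, hlp⟩ := exists_word hgen g h
  obtain ⟨m, hm, hmA, hmp⟩ := exists_word hgen h k
  rw [← hl, ← hm, ← List.length_append]
  refine wordDist_le _ (fun x hx => ?_) ?_
  · exact (List.mem_append.1 hx).elim (hlA x) (hmA x)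
  · rw [List.prod_append, hlp, hmp]; group

theorem wordDist_comm_le (hgen : Subgroup.closure A = ⊤)
    (g h : G) : wordDist A h g ≤ wordDist A g h := by
  obtain ⟨l, hl, hlA, hlp⟩ := exists_word hgen g h
  rw [← hl]
  refine (wordDist_le (l.map (·⁻¹)).reverse (fun x hx => ?_) ?_).trans (by simp)
  · simp only [List.mem_reverse, List.mem_map] at hx
    obtain ⟨y, hy, rfl⟩ := hx
    exact inv_mem_gens (hlA y hy)
  · rw [← List.prod_inv_reverse, hlp]; group

theorem wordDist_comm (hgen : Subgroup.closure A = ⊤) (g h : G) : wordDist A g h = wordDist A h g :=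
  le_antisymm (wordDist_comm_le hgen h g) (wordDist_comm_le hgen g h)

theorem eq_of_wordDist_eq_zero (hgen : Subgroup.closure A = ⊤)
    {g h : G} (hd : wordDist A g h = 0) : g = h := by
  obtain ⟨l, hl, -, hlp⟩ := exists_word hgen g h
  rw [hd, List.length_eq_zero_iff] at hl
  subst hl
  exact inv_mul_eq_one.1 hlp.symm

theorem eq_or_eq_mul_of_wordDist_le_one (hgen : Subgroup.closure A = ⊤)
    {g h : G} (hd : wordDist A g h ≤ 1) :
    h = g ∨ ∃ s ∈ A ∪ A⁻¹, h = g * s := by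
  obtain ⟨l, hl, hlA, hlp⟩ := exists_word hgen g h
  rcases l with _ | ⟨s, _ | ⟨t, l⟩⟩
  · exact Or.inl (inv_mul_eq_one.1 hlp.symm).symm
  · refine Or.inr ⟨s, hlA s (by simp), ?_⟩
    simp only [List.prod_cons, List.prod_nil, mul_one] at hlp
    rw [hlp, mul_inv_cancel_left]
  · simp only [List.length_cons] at hl; lia

theorem finite_ball (hgen : Subgroup.closure A = ⊤)
    (hA : A.Finite) (g : G) (n : ℕ) : {h | wordDist A g h ≤ n}.Finite := by
  have hS : (A ∪ A⁻¹).Finite := hA.union hA.inv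
  induction n with
  | zero =>
    refine (Set.finite_singleton g).subset fun h hh => ?_
    exact (eq_of_wordDist_eq_zero hgen (Nat.le_zero.1 hh)).symm
  | succ n ih =>
    refine (ih.union (Set.Finite.image2 (fun x s => x * s) ih hS)).subset fun h hh => ?_
    obtain ⟨l, hl, hlA, hlp⟩ := exists_word hgen g h
    rcases l.eq_nil_or_concat with rfl | ⟨l, s, rfl⟩
    · left
      have : wordDist A g h = 0 := by simpa using hl.symm
      simp [this]
    · right
      refine ⟨h * s⁻¹, ?_, s, hlA s (by simp), by simp⟩
      rw [Set.mem_ofPred_eq] at hh ⊢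
      have hlen : l.length + 1 = wordDist A g h := by simpa using hl
      refine (wordDist_le l (fun x hx => hlA x (by simp [hx])) ?_).trans (by lia)
      rw [List.prod_concat] at hlp
      rw [← mul_assoc, ← hlp, mul_inv_cancel_right]

theorem wordDist_le_of_path (hgen : Subgroup.closure A = ⊤)
    {γ : ℕ → G} {m : ℕ} (hγ : IsDiscPath A γ m) {i j : ℕ} (hij : i ≤ j)
    (hj : j ≤ m) : wordDist A (γ i) (γ j) ≤ j - i := by
  induction j, hij using Nat.le_induction with
  | base => simp
  | succ j hij ih =>
    have h1 := wordDist_triangle hgen (γ i) (γ j) (γ (j + 1))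
    have h2 := hγ j (by lia)
    have h3 := ih (by lia)
    lia

theorem isDiscGeodesic_of_path (hgen : Subgroup.closure A = ⊤)
    {γ : ℕ → G} {m : ℕ} (hγ : IsDiscPath A γ m)
    (hm : wordDist A (γ 0) (γ m) = m) : IsDiscGeodesic A γ m := by
  have key : ∀ i j, i ≤ j → j ≤ m → wordDist A (γ i) (γ j) = j - i := by
    intro i j hij hj
    have h1 := wordDist_le_of_path hgen hγ (Nat.zero_le i) (hij.trans hj)
    have h2 := wordDist_le_of_path hgen hγ hij hj
    have h3 := wordDist_le_of_path hgen hγ hj le_rfl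
    have h4 := wordDist_triangle hgen (γ 0) (γ i) (γ m)
    have h5 := wordDist_triangle hgen (γ i) (γ j) (γ m)
    lia
  intro i hi j hj
  rcases le_total i j with h | h
  · rw [key i j h hj, abs_of_nonpos (by lia)]; lia
  · rw [wordDist_comm hgen, key j i h hi, abs_of_nonneg (by lia)]; lia

/-- A point at which the triangle inequality is an equality lies on a discrete geodesic. -/
theorem exists_geodesic_through (hgen : Subgroup.closure A = ⊤) {g z h : G}
    (hz : wordDist A g z + wordDist A z h = wordDist A g h) :
    ∃ (γ : ℕ → G) (m : ℕ), IsDiscGeodesic A γ m ∧ γ 0 = g ∧ γ m = h ∧ ∃ i ≤ m, γ i = z := by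
  obtain ⟨l, hl, hlA, hlp⟩ := exists_word hgen g z
  obtain ⟨k, hk, hkA, hkp⟩ := exists_word hgen z h
  let γ : ℕ → G := fun i => g * ((l ++ k).take i).prod
  have hm : γ (wordDist A g h) = h := by
    have : (l ++ k).length = wordDist A g h := by rw [List.length_append, hl, hk, hz]
    simp only [γ, ← this, List.take_length, List.prod_append, hlp, hkp]
    group
  have h0 : γ 0 = g := by simp [γ]
  refine ⟨γ, wordDist A g h, isDiscGeodesic_of_path hgen ?_ (by rw [hm, h0]), h0, hm,
    wordDist A g z, by lia, ?_⟩
  · intro i hi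
    have hlen : i < (l ++ k).length := by rw [List.length_append]; lia
    have : γ (i + 1) = γ i * (l ++ k)[i] := by
      simp only [γ, mul_assoc]
      rw [List.prod_take_succ _ _ hlen]
    rw [this]
    refine wordDist_mul_gen_le ?_ _
    exact (List.mem_append.1 (List.getElem_mem hlen)).elim (hlA _) (hkA _)
  · simp only [γ, ← hl, List.take_left', hlp]
    group

theorem exists_at_wordDist (hgen : Subgroup.closure A = ⊤)
    {g h : G} {i : ℕ} (hi : i ≤ wordDist A g h) :
    ∃ z, wordDist A g z = i ∧ wordDist A z h = wordDist A g h - i := by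
  obtain ⟨γ, m, hγ, rfl, rfl, -⟩ := exists_geodesic_through hgen (g := g) (z := g) (h := h)
    (by simp)
  have h1 := hγ.wordDist_eq (Nat.zero_le m) le_rfl
  have h2 := hγ.wordDist_eq (Nat.zero_le i) (by lia)
  have h3 := hγ.wordDist_eq (i := i) (by lia) le_rfl
  exact ⟨γ i, by lia, by lia⟩

end WordMetric

section Connectedness

variable {G : Type*} [Group G] {A : Set G}

/-- There is a path from `x` to `y` all of whose vertices, except possibly `x`, are in `Y`. -/
def JoinedThrough (A Y : Set G) : G → G → Prop :=
  Relation.ReflTransGen fun x y => y ∈ Y ∧ ∃ s ∈ A ∪ A⁻¹, y = x * s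

/-- A subset of the Cayley graph is connected. -/
def CayleyConnected (A Y : Set G) : Prop :=
  ∀ x ∈ Y, ∀ y ∈ Y, JoinedThrough A Y x y

theorem JoinedThrough.mem {Y : Set G} {x y : G} (h : JoinedThrough A Y x y) (hx : x ∈ Y) :
    y ∈ Y := by
  cases h with
  | refl => exact hx
  | tail _ h => exact h.1

theorem JoinedThrough.symm {Y : Set G} {x y : G} (h : JoinedThrough A Y x y) (hx : x ∈ Y) :
    JoinedThrough A Y y x := by
  induction h with
  | refl => exact Relation.ReflTransGen.refl
  | @tail b c hab h ih =>
    obtain ⟨hc, s, hs, rfl⟩ := h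
    exact Relation.ReflTransGen.head ⟨JoinedThrough.mem hab hx, s⁻¹, inv_mem_gens hs, by simp⟩ ih

theorem JoinedThrough.exists_path {Y : Set G} {x y : G} (h : JoinedThrough A Y x y)
    (hx : x ∈ Y) : ∃ (γ : ℕ → G) (m : ℕ), IsDiscPath A γ m ∧ γ 0 = x ∧ γ m = y ∧
      ∀ i ≤ m, γ i ∈ Y := by
  induction h with
  | refl => exact ⟨fun _ => x, 0, fun i hi => by lia, rfl, rfl, fun _ _ => hx⟩
  | @tail b c _ h ih =>
    obtain ⟨γ, m, h1, h2, h3, h4⟩ := ih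
    obtain ⟨hc, s, hs, rfl⟩ := h
    refine ⟨fun i => if i ≤ m then γ i else b * s, m + 1, ?_, by simpa, by simp, ?_⟩
    · intro i hi
      rcases Nat.lt_succ_iff_lt_or_eq.1 hi with hi | rfl
      · have : i + 1 ≤ m := hi
        simpa [hi.le, this] using h1 i hi
      · simpa [h3] using wordDist_mul_gen_le hs b
    · intro i hi
      by_cases him : i ≤ m
      · simpa [him] using h4 i him
      · simpa [him] using hc

theorem CayleyConnected.eq_of_closed {X Y : Set G} (hY : CayleyConnected A Y) (hXY : X ⊆ Y)
    (hX : X.Nonempty) (hcl : ∀ x ∈ X, ∀ s ∈ A ∪ A⁻¹, x * s ∈ Y → x * s ∈ X) : X = Y := by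
  refine hXY.antisymm fun y hy => ?_
  obtain ⟨x, hx⟩ := hX
  have h := hY x (hXY hx) y hy
  induction h with
  | refl => exact hx
  | @tail b c hab h ih =>
    obtain ⟨hc, s, hs, rfl⟩ := h
    exact hcl b (ih (JoinedThrough.mem hab (hXY hx))) s hs hc

theorem cayleyConnected_component (Y : Set G) (x : G) :
    CayleyConnected A {y | JoinedThrough A Y x y} := by
  have key : ∀ y, JoinedThrough A Y x y → JoinedThrough A {y | JoinedThrough A Y x y} x y := by
    intro y h
    induction h with
    | refl => exact Relation.ReflTransGen.refl
    | tail h h' ih => exact ih.tail ⟨h.tail h', h'.2⟩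
  intro y hy z hz
  exact ((key y hy).symm Relation.ReflTransGen.refl).trans (key z hz)

theorem JoinedThrough.mono {X Y : Set G} (h : X ⊆ Y) {x y : G} (hxy : JoinedThrough A X x y) :
    JoinedThrough A Y x y :=
  Relation.ReflTransGen.mono (fun _ _ hab => ⟨h hab.1, hab.2⟩) _ _ hxy

/-- Connected sets pass uniformly close to every point of every geodesic between their points. -/
def Bottleneck (A : Set G) (ε : ℕ) : Prop :=
  ∀ (Y : Set G) (g h z : G), CayleyConnected A Y → g ∈ Y → h ∈ Y →
    wordDist A g z + wordDist A z h = wordDist A g h → ∃ y ∈ Y, wordDist A z y ≤ ε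

theorem bottleneck_of_geodesics_near_paths (hgen : Subgroup.closure A = ⊤) {ε : ℝ}
    (H : ∀ (g h : G) (γ γ' : ℕ → G) (m m' : ℕ),
      IsDiscGeodesic A γ m → IsDiscPath A γ' m' → γ 0 = g → γ m = h → γ' 0 = g → γ' m' = h →
      ∀ i ≤ m, ∃ j ≤ m', (wordDist A (γ i) (γ' j) : ℝ) ≤ ε) : Bottleneck A ⌊ε⌋₊ := by
  intro Y g h z hY hg hh hz
  obtain ⟨γ, m, h1, h2, h3, i, hi, rfl⟩ := exists_geodesic_through hgen hz
  obtain ⟨γ', m', h1', h2', h3', h4'⟩ := (hY g hg h hh).exists_path hg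
  obtain ⟨j, hj, hd⟩ := H g h γ γ' m m' h1 h1' h2 h3 h2' h3' i hi
  exact ⟨γ' j, h4' j hj, Nat.le_floor hd⟩

end Connectedness

open scoped Pointwise


section Coboundaries

variable {G : Type*} [Group G]

/-- The points `x` such that exactly one of `x` and `x * s` is in `C`. -/
def cobd (s : G) (C : Set G) : Set G := {x | ¬(x ∈ C ↔ x * s ∈ C)}

theorem mem_cobd {s x : G} {C : Set G} : x ∈ cobd s C ↔ ¬(x ∈ C ↔ x * s ∈ C) := Iff.rfl

@[simp] theorem cobd_compl (s : G) (C : Set G) : cobd s Cᶜ = cobd s C := by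
  ext x; simp only [mem_cobd, Set.mem_compl_iff]; tauto

theorem cobd_smul (g s : G) (C : Set G) : cobd s (g • C) = g • cobd s C := by
  ext x
  simp [mem_cobd, Set.mem_smul_set_iff_inv_smul_mem, mul_assoc]

theorem cobd_inter_subset (s : G) (C D : Set G) : cobd s (C ∩ D) ⊆ cobd s C ∪ cobd s D := by
  intro x; simp only [mem_cobd, Set.mem_inter_iff, Set.mem_union]; tauto

theorem cobd_union_subset (s : G) (C D : Set G) : cobd s (C ∪ D) ⊆ cobd s C ∪ cobd s D := by
  intro x; simp only [mem_cobd, Set.mem_union]; tauto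

/-- Sets that are almost invariant under right translations. -/
def Thin (C : Set G) : Prop := ∀ s, (cobd s C).Finite

theorem Thin.compl {C : Set G} (h : Thin C) : Thin Cᶜ := fun s => by simpa using h s

theorem Thin.smul {C : Set G} (h : Thin C) (g : G) : Thin (g • C) := fun s => by
  rw [cobd_smul]; exact (h s).smul_set

theorem Thin.inter {C D : Set G} (hC : Thin C) (hD : Thin D) : Thin (C ∩ D) := fun s =>
  ((hC s).union (hD s)).subset (cobd_inter_subset s C D)

theorem Thin.union {C D : Set G} (hC : Thin C) (hD : Thin D) : Thin (C ∪ D) := fun s =>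
  ((hC s).union (hD s)).subset (cobd_union_subset s C D)

theorem thin_of_gens {A : Set G} (hgen : Subgroup.closure A = ⊤) {C : Set G}
    (h : ∀ s ∈ A, (cobd s C).Finite) : Thin C := by
  intro s
  have hs : s ∈ Subgroup.closure A := by rw [hgen]; trivial
  induction hs using Subgroup.closure_induction with
  | mem s hs => exact h s hs
  | one => convert Set.finite_empty; ext x; simp [mem_cobd]
  | mul s t _ _ h1 h2 =>
    refine (h1.union (h2.preimage (f := fun x => x * s) (mul_left_injective s).injOn)).subset ?_
    intro x
    simp only [mem_cobd, Set.mem_union, Set.mem_preimage, mul_assoc]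
    tauto
  | inv s _ h1 =>
    refine (h1.preimage (f := fun x => x * s⁻¹) (mul_left_injective _).injOn).subset ?_
    intro x
    simp only [mem_cobd, Set.mem_preimage, inv_mul_cancel_right]
    tauto

/-- The number of edges, with labels in `T`, in the coboundary of `C`. -/
noncomputable def cutSize (T : Finset G) (C : Set G) : ℕ := ∑ s ∈ T, (cobd s C).ncard

@[simp] theorem cutSize_compl (T : Finset G) (C : Set G) : cutSize T Cᶜ = cutSize T C := by
  simp [cutSize]

@[simp] theorem cutSize_smul (T : Finset G) (g : G) (C : Set G) :
    cutSize T (g • C) = cutSize T C := by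
  simp [cutSize, cobd_smul, Set.ncard_smul_set]

theorem cutSize_mono {T : Finset G} {C D : Set G} (hD : Thin D)
    (h : ∀ s ∈ T, cobd s C ⊆ cobd s D) : cutSize T C ≤ cutSize T D :=
  Finset.sum_le_sum fun s hs => Set.ncard_le_ncard (h s hs) (hD s)

theorem cutSize_lt {T : Finset G} {C D : Set G} (hD : Thin D)
    (h : ∀ s ∈ T, cobd s C ⊆ cobd s D) (h' : ∃ s ∈ T, ∃ x ∈ cobd s D, x ∉ cobd s C) :
    cutSize T C < cutSize T D := by
  obtain ⟨s, hs, x, hx, hx'⟩ := h'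
  refine Finset.sum_lt_sum (fun s hs => Set.ncard_le_ncard (h s hs) (hD s)) ⟨s, hs, ?_⟩
  exact Set.ncard_lt_ncard ((Set.ssubset_iff_of_subset (h s hs)).2 ⟨x, hx, hx'⟩) (hD s)

theorem ncard_cobd_inter_add_union {C D : Set G} (hC : Thin C) (hD : Thin D) (s : G) :
    (cobd s (C ∩ D)).ncard + (cobd s (C ∪ D)).ncard ≤ (cobd s C).ncard + (cobd s D).ncard ∧
      ((∃ x ∈ C \ D, x * s ∈ D \ C) → (cobd s (C ∩ D)).ncard + (cobd s (C ∪ D)).ncard <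
        (cobd s C).ncard + (cobd s D).ncard) := by
  have h1 := Set.ncard_union_add_ncard_inter (cobd s (C ∩ D)) (cobd s (C ∪ D))
    (hC.inter hD s) (hC.union hD s)
  have h2 := Set.ncard_union_add_ncard_inter (cobd s C) (cobd s D) (hC s) (hD s)
  have h3 : cobd s (C ∩ D) ∪ cobd s (C ∪ D) ⊆ cobd s C ∪ cobd s D :=
    Set.union_subset (cobd_inter_subset s C D) (cobd_union_subset s C D)
  have h4 : cobd s (C ∩ D) ∩ cobd s (C ∪ D) ⊆ cobd s C ∩ cobd s D := by
    intro x
    simp only [mem_cobd, Set.mem_union, Set.mem_inter_iff]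
    tauto
  have h5 := Set.ncard_le_ncard h3 ((hC s).union (hD s))
  have h6 := Set.ncard_le_ncard h4 ((hC s).subset Set.inter_subset_left)
  refine ⟨by lia, ?_⟩
  rintro ⟨x, ⟨hx1, hx2⟩, hx3, hx4⟩
  have h7 := Set.ncard_lt_ncard ((Set.ssubset_iff_of_subset h4).2 ⟨x, ?_, ?_⟩)
    ((hC s).subset Set.inter_subset_left)
  · lia
  · simp [mem_cobd, hx1, hx2, hx3, hx4]
  · simp [mem_cobd, hx1, hx2, hx3, hx4]

theorem cutSize_inter_add_union_le {C D : Set G} (hC : Thin C) (hD : Thin D) (T : Finset G) :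
    cutSize T (C ∩ D) + cutSize T (C ∪ D) ≤ cutSize T C + cutSize T D := by
  simp only [cutSize, ← Finset.sum_add_distrib]
  exact Finset.sum_le_sum fun s _ => (ncard_cobd_inter_add_union hC hD s).1

theorem cutSize_inter_add_union_lt {C D : Set G} (hC : Thin C) (hD : Thin D) {T : Finset G}
    (h : ∃ s ∈ T, ∃ x ∈ C \ D, x * s ∈ D \ C) :
    cutSize T (C ∩ D) + cutSize T (C ∪ D) < cutSize T C + cutSize T D := by
  obtain ⟨s, hs, h⟩ := h
  simp only [cutSize, ← Finset.sum_add_distrib]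
  exact Finset.sum_lt_sum (fun s _ => (ncard_cobd_inter_add_union hC hD s).1)
    ⟨s, hs, (ncard_cobd_inter_add_union hC hD s).2 h⟩

/-- The weight of a set: the sizes of its coboundary for two sets of labels, ordered
lexicographically. -/
noncomputable def cutWeight (S B : Finset G) (C : Set G) : ℕ ×ₗ ℕ :=
  toLex (cutSize S C, cutSize B C)

@[simp] theorem cutWeight_compl (S B : Finset G) (C : Set G) :
    cutWeight S B Cᶜ = cutWeight S B C := by
  simp [cutWeight]

@[simp] theorem cutWeight_smul (S B : Finset G) (g : G) (C : Set G) :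
    cutWeight S B (g • C) = cutWeight S B C := by
  simp [cutWeight]

theorem cutWeight_inter_add_union_lt {C D : Set G} (hC : Thin C) (hD : Thin D) {S B : Finset G}
    (h : ∃ s ∈ B, ∃ x ∈ C \ D, x * s ∈ D \ C) :
    cutWeight S B (C ∩ D) + cutWeight S B (C ∪ D) < cutWeight S B C + cutWeight S B D := by
  simp only [cutWeight, ← toLex_add, Prod.mk_add_mk, Prod.Lex.toLex_lt_toLex]
  have h1 := cutSize_inter_add_union_le hC hD S
  have h2 := cutSize_inter_add_union_lt hC hD h
  lia

end Coboundaries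

section OptimalCuts

variable {G : Type*} [Group G]

/-- A thin set that contains a neighbourhood of the end `U`, but not of the end `V`. -/
def Separates (U V : Ultrafilter G) (C : Set G) : Prop := Thin C ∧ C ∈ U ∧ C ∉ V

theorem Separates.compl {U V : Ultrafilter G} {C : Set G} (h : Separates U V C) :
    Separates V U Cᶜ :=
  ⟨h.1.compl, Ultrafilter.compl_mem_iff_notMem.2 h.2.2, fun h' =>
    Ultrafilter.compl_mem_iff_notMem.1 h' h.2.1⟩

/-- The sets of minimal weight among those that separate two given nonprincipal ultrafilters. -/
def optimalCuts (S B : Finset G) : Set (Set G) :=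
  {C | ∃ U V : Ultrafilter G, (U : Filter G) ≤ Filter.cofinite ∧ (V : Filter G) ≤ Filter.cofinite ∧
    Separates U V C ∧ ∀ D, Separates U V D → cutWeight S B C ≤ cutWeight S B D}

variable {S B : Finset G}

theorem exists_optimalCut {U V : Ultrafilter G} (hU : (U : Filter G) ≤ Filter.cofinite)
    (hV : (V : Filter G) ≤ Filter.cofinite) (h : ∃ C, Separates U V C) :
    ∃ C ∈ optimalCuts S B, Separates U V C := by
  let s : Set (Set G) := {C | Separates U V C}
  obtain ⟨C, hC, hmin⟩ := (InvImage.wf (cutWeight S B) wellFounded_lt).has_min s h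
  exact ⟨C, ⟨U, V, hU, hV, hC, fun D hD => not_lt.1 (hmin D hD)⟩, hC⟩

theorem compl_mem_optimalCuts {C : Set G} (h : C ∈ optimalCuts S B) : Cᶜ ∈ optimalCuts S B := by
  obtain ⟨U, V, hU, hV, hC, hmin⟩ := h
  refine ⟨V, U, hV, hU, hC.compl, fun D hD => ?_⟩
  have := hmin Dᶜ hD.compl
  simpa using this

theorem smul_mem_optimalCuts {C : Set G} (h : C ∈ optimalCuts S B) (g : G) :
    g • C ∈ optimalCuts S B := by
  obtain ⟨U, V, hU, hV, hC, hmin⟩ := h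
  have key : ∀ (k : G) (D : Set G) (W : Ultrafilter G),
      D ∈ W.map (fun x => k * x) ↔ k⁻¹ • D ∈ W := fun k D W => by
    rw [Ultrafilter.mem_map, ← Set.preimage_smul]; rfl
  have hcof : ∀ W : Ultrafilter G, (W : Filter G) ≤ Filter.cofinite →
      ((W.map (fun x => g * x) : Ultrafilter G) : Filter G) ≤ Filter.cofinite := fun W hW =>
    (Filter.map_mono hW).trans (mul_right_injective g).tendsto_cofinite
  have hsep : ∀ D, Separates (U.map (fun x => g * x)) (V.map (fun x => g * x)) D →
      Separates U V (g⁻¹ • D) := fun D hD =>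
    ⟨hD.1.smul _, (key _ _ _).1 hD.2.1, fun h => hD.2.2 ((key _ _ _).2 h)⟩
  refine ⟨U.map (fun x => g * x), V.map (fun x => g * x), hcof U hU, hcof V hV,
    ⟨hC.1.smul g, ?_, ?_⟩,
    fun D hD => ?_⟩
  · rw [key, inv_smul_smul]; exact hC.2.1
  · rw [key, inv_smul_smul]; exact hC.2.2
  · simpa using hmin _ (hsep D hD)

theorem thin_of_mem_optimalCuts {C : Set G} (h : C ∈ optimalCuts S B) : Thin C := by
  obtain ⟨U, V, -, -, hC, -⟩ := h
  exact hC.1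

theorem nonempty_of_mem_optimalCuts {C : Set G} (h : C ∈ optimalCuts S B) : C.Nonempty := by
  obtain ⟨U, V, -, -, hC, -⟩ := h
  exact U.nonempty_of_mem hC.2.1

end OptimalCuts

section Components

variable {G : Type*} [Group G] {A : Set G}

/-- The endpoints of the edges in the coboundary of `C`. -/
def bdry (A C : Set G) : Set G := {x | ∃ s ∈ A ∪ A⁻¹, x ∈ cobd s C}

@[simp] theorem bdry_compl (C : Set G) : bdry A Cᶜ = bdry A C := by simp [bdry]

theorem mul_mem_bdry {C : Set G} {s x : G} (hs : s ∈ A ∪ A⁻¹) (hx : x ∈ cobd s C) :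
    x * s ∈ bdry A C :=
  ⟨s⁻¹, inv_mem_gens hs, by rw [mem_cobd] at hx ⊢; rw [mul_inv_cancel_right]; tauto⟩

theorem exists_mem_bdry_between (hgen : Subgroup.closure A = ⊤) {C : Set G} {x y : G}
    (hx : x ∈ C) (hy : y ∉ C) :
    ∃ z ∈ C, z ∈ bdry A C ∧ wordDist A x z + wordDist A z y = wordDist A x y := by
  induction hn : wordDist A x y generalizing x with
  | zero =>
    rw [eq_of_wordDist_eq_zero hgen hn] at hx
    exact absurd hx hy
  | succ n ih =>
    obtain ⟨x', h1, h2⟩ := exists_at_wordDist hgen (g := x) (h := y) (i := 1) (by lia)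
    rcases eq_or_eq_mul_of_wordDist_le_one hgen h1.le with rfl | ⟨s, hs, rfl⟩
    · simp at h1
    by_cases hx' : x * s ∈ C
    · obtain ⟨z, hz, hz1, hz2⟩ := ih hx' (by lia)
      refine ⟨z, hz, hz1, ?_⟩
      have h3 := wordDist_triangle hgen x (x * s) z
      have h4 := wordDist_triangle hgen x z y
      lia
    · exact ⟨x, hx, ⟨s, hs, by simp [mem_cobd, hx, hx']⟩, by simpa using hn⟩

theorem exists_exit (hgen : Subgroup.closure A = ⊤) {C : Set G} {x y : G}
    (hx : x ∈ C) (hy : y ∉ C) : ∃ z ∈ C, ∃ s ∈ A ∪ A⁻¹, z * s ∉ C := by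
  obtain ⟨z, hz, ⟨s, hs, h⟩, -⟩ := exists_mem_bdry_between hgen hx hy
  exact ⟨z, hz, s, hs, fun h' => h (by simp [hz, h'])⟩

theorem eq_univ_of_mul_mem (hgen : Subgroup.closure A = ⊤) {C : Set G} (hC : C.Nonempty)
    (h : ∀ x ∈ C, ∀ s ∈ A ∪ A⁻¹, x * s ∈ C) (y : G) : y ∈ C := by
  by_contra hy
  obtain ⟨x, hx⟩ := hC
  obtain ⟨z, hz, s, hs, h'⟩ := exists_exit hgen hx hy
  exact h' (h z hz s hs)

theorem thin_of_symm_gens (hgen : Subgroup.closure A = ⊤) {C D : Set G} (hD : Thin D)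
    (h : ∀ s ∈ A ∪ A⁻¹, cobd s C ⊆ cobd s D) : Thin C :=
  thin_of_gens hgen fun s hs => (hD s).subset (h s (Or.inl hs))

/-- The connected component of `x` in `Y`. -/
def component (A Y : Set G) (x : G) : Set G := {y | JoinedThrough A Y x y}

theorem mem_component_self (Y : Set G) (x : G) : x ∈ component A Y x :=
  Relation.ReflTransGen.refl

theorem component_subset {Y : Set G} {x : G} (hx : x ∈ Y) : component A Y x ⊆ Y :=
  fun _ hy => JoinedThrough.mem hy hx

theorem component_eq_of_mem {Y : Set G} {x y : G} (hx : x ∈ Y) (hy : y ∈ component A Y x) :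
    component A Y y = component A Y x := by
  ext z
  exact ⟨fun h => Relation.ReflTransGen.trans hy h,
    fun h => Relation.ReflTransGen.trans (JoinedThrough.symm hy hx) h⟩

theorem mul_mem_component {Y : Set G} {x y s : G} (hs : s ∈ A ∪ A⁻¹) (hy : y ∈ component A Y x)
    (hys : y * s ∈ Y) : y * s ∈ component A Y x :=
  Relation.ReflTransGen.tail hy ⟨hys, s, hs, rfl⟩

theorem cobd_subset_of_closed {Y K : Set G} (hK : K ⊆ Y)
    (h : ∀ y ∈ K, ∀ s ∈ A ∪ A⁻¹, y * s ∈ Y → y * s ∈ K) : ∀ s ∈ A ∪ A⁻¹, cobd s K ⊆ cobd s Y := by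
  intro s hs y hy
  rw [mem_cobd] at hy ⊢
  have h1 := h y
  have h2 : y * s ∈ K → y ∈ Y → y ∈ K := fun h3 h4 => by
    have := h _ h3 s⁻¹ (inv_mem_gens hs)
    rw [mul_inv_cancel_right] at this
    exact this h4
  have h3 := @hK y
  have h4 := @hK (y * s)
  have h5 := h1
  by_cases hyK : y ∈ K
  · have := h1 hyK s hs
    tauto
  · tauto

theorem cobd_component_subset {Y : Set G} {x : G} (hx : x ∈ Y) :
    ∀ s ∈ A ∪ A⁻¹, cobd s (component A Y x) ⊆ cobd s Y :=
  cobd_subset_of_closed (component_subset hx) fun _ hy _ hs => mul_mem_component hs hy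

theorem thin_of_finite {N : Set G} (hN : N.Finite) : Thin N := fun s => by
  refine (hN.union (hN.preimage (f := fun x => x * s) (mul_left_injective s).injOn)).subset ?_
  intro x
  simp only [mem_cobd, Set.mem_union, Set.mem_preimage]
  tauto

theorem thin_component (hgen : Subgroup.closure A = ⊤) {N : Set G} (hN : N.Finite) {x : G}
    (hx : x ∉ N) : Thin (component A Nᶜ x) :=
  thin_of_symm_gens hgen (thin_of_finite hN).compl (cobd_component_subset hx)

/-- A nonprincipal ultrafilter contains a component of the complement of each finite set. -/
theorem exists_component_mem (hgen : Subgroup.closure A = ⊤) (hA : A.Finite) {N : Set G}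
    (hN : N.Finite) {U : Ultrafilter G} (hU : (U : Filter G) ≤ Filter.cofinite) :
    ∃ x ∉ N, component A Nᶜ x ∈ U := by
  have hNU : Nᶜ ∈ U := hU hN.compl_mem_cofinite
  rcases N.eq_empty_or_nonempty with rfl | ⟨n, hn⟩
  · refine ⟨1, by simp, ?_⟩
    have : component A ∅ᶜ (1 : G) = Set.univ :=
      Set.eq_univ_of_forall (eq_univ_of_mul_mem hgen ⟨1, mem_component_self _ _⟩
        fun x hx s hs => mul_mem_component hs hx (by simp))
    rw [this]
    exact Filter.univ_mem
  let F : Set G := {z | z ∉ N ∧ ∃ s ∈ A ∪ A⁻¹, z * s ∈ N}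
  have hF : F.Finite := by
    refine ((hA.union hA.inv).biUnion fun s _ =>
      hN.preimage (f := fun x => x * s) (mul_left_injective s).injOn).subset ?_
    rintro z ⟨-, s, hs, hz⟩
    exact Set.mem_biUnion hs hz
  have hcov : Nᶜ ⊆ ⋃ z ∈ F, component A Nᶜ z := by
    intro x hx
    obtain ⟨z, hz, s, hs, hzs⟩ := exists_exit hgen (mem_component_self (A := A) Nᶜ x)
      (fun h => component_subset hx h hn)
    have hzN : z ∉ N := component_subset hx hz
    have : z * s ∈ N := by
      by_contra h
      exact hzs (mul_mem_component hs hz h)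
    refine Set.mem_biUnion (show z ∈ F from ⟨hzN, s, hs, this⟩) ?_
    exact JoinedThrough.symm hz hx
  obtain ⟨z, hz, hzU⟩ := (Ultrafilter.finite_biUnion_mem_iff hF).1 (Filter.mem_of_superset hNU hcov)
  exact ⟨z, hz.1, hzU⟩

end Components

section BoundedCuts

variable {G : Type*} [Group G] {A : Set G} {ε : ℕ}

theorem cayleyConnected_mono_component {X Y : Set G} (h : X ⊆ Y) (x : G) :
    component A X x ⊆ component A Y x := fun _ hy => hy.mono h

/-- In the presence of bottlenecks, any two separable ends are separated by a component of the
complement of a ball of fixed radius. -/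
theorem exists_component_separates (hgen : Subgroup.closure A = ⊤) (hA : A.Finite)
    (hB : Bottleneck A ε) {U V : Ultrafilter G} (hU : (U : Filter G) ≤ Filter.cofinite)
    (hV : (V : Filter G) ≤ Filter.cofinite) {D : Set G} (hD : Separates U V D) :
    ∃ z x, x ∉ {h | wordDist A z h ≤ ε} ∧
      Separates U V (component A {h | wordDist A z h ≤ ε}ᶜ x) := by
  have hfin : (bdry A D).Finite :=
    ((hA.union hA.inv).biUnion fun s _ => hD.1 s).subset fun x ⟨s, hs, hx⟩ => Set.mem_biUnion hs hx
  let N : Set G := ⋃ z ∈ bdry A D, {h | wordDist A z h ≤ ε}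
  have hN : N.Finite := hfin.biUnion fun z _ => finite_ball hgen hA z ε
  obtain ⟨a, ha, haU⟩ := exists_component_mem hgen hA hN hU
  obtain ⟨b, hb, hbV⟩ := exists_component_mem hgen hA hN hV
  obtain ⟨x, hx, hxD⟩ := U.nonempty_of_mem (Filter.inter_mem haU hD.2.1)
  obtain ⟨y, hy, hyD⟩ := V.nonempty_of_mem
    (Filter.inter_mem hbV (Ultrafilter.compl_mem_iff_notMem.2 hD.2.2))
  obtain ⟨z, -, hz, hxy⟩ := exists_mem_bdry_between hgen hxD hyD
  have hsub : {h | wordDist A z h ≤ ε} ⊆ N :=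
    Set.subset_biUnion_of_mem (u := fun z => {h | wordDist A z h ≤ ε}) hz
  have hxN : x ∉ N := component_subset ha hx
  have hyN : y ∉ N := component_subset hb hy
  have hxz : x ∉ {h | wordDist A z h ≤ ε} := fun h => hxN (hsub h)
  have hyz : y ∉ {h | wordDist A z h ≤ ε} := fun h => hyN (hsub h)
  have hsub' : Nᶜ ⊆ {h | wordDist A z h ≤ ε}ᶜ := Set.compl_subset_compl.2 hsub
  refine ⟨z, x, hxz, thin_component hgen (finite_ball hgen hA z ε) hxz, ?_, fun hmem => ?_⟩
  · refine Filter.mem_of_superset haU ?_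
    rw [← component_eq_of_mem ha hx]
    exact cayleyConnected_mono_component hsub' x
  · obtain ⟨w, hw1, hw2⟩ := V.nonempty_of_mem (Filter.inter_mem hbV hmem)
    rw [← component_eq_of_mem hb hy] at hw1
    have hyx : y ∈ component A {h | wordDist A z h ≤ ε}ᶜ x := by
      rw [← component_eq_of_mem hxz hw2,
        component_eq_of_mem hyz (cayleyConnected_mono_component hsub' y hw1)]
      exact mem_component_self _ _
    obtain ⟨c, hc, hc'⟩ := hB _ x y z (cayleyConnected_component _ x)
      (mem_component_self _ _) hyx hxy
    exact component_subset hxz hc hc'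

theorem exists_cutSize_component_le (hgen : Subgroup.closure A = ⊤) (hA : A.Finite)
    {S : Finset G} (hS : (S : Set G) = A ∪ A⁻¹) (ε : ℕ) :
    ∃ k, ∀ z x, x ∉ {h | wordDist A z h ≤ ε} →
      cutSize S (component A {h | wordDist A z h ≤ ε}ᶜ x) ≤ k := by
  refine ⟨cutSize S {h | wordDist A 1 h ≤ ε}, fun z x hx => ?_⟩
  have h1 : {h | wordDist A z h ≤ ε} = z • {h | wordDist A 1 h ≤ ε} := by
    ext h
    rw [Set.mem_smul_set_iff_inv_smul_mem]
    simp only [Set.mem_ofPred_eq, smul_eq_mul]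
    rw [← wordDist_mul_left z 1, mul_one, mul_inv_cancel_left]
  rw [← cutSize_smul S z {h | wordDist A 1 h ≤ ε}, ← h1, ← cutSize_compl S {h | wordDist A z h ≤ ε}]
  have hfin := finite_ball hgen hA z ε
  exact cutSize_mono (thin_of_finite hfin).compl fun s hs =>
    cobd_component_subset hx s (by rw [← hS]; exact hs)

/-- Cuts that minimize the weight are connected. -/
theorem connected_of_mem_optimalCuts (hgen : Subgroup.closure A = ⊤)
    {S B : Finset G} (hS : (S : Set G) = A ∪ A⁻¹) {C : Set G} (hC : C ∈ optimalCuts S B) :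
    CayleyConnected A C := by
  obtain ⟨U, V, hU, hV, hsep, hmin⟩ := hC
  have hV' : Cᶜ ∈ V := Ultrafilter.compl_mem_iff_notMem.2 hsep.2.2
  obtain ⟨v, hv⟩ := V.nonempty_of_mem hV'
  have key : ∀ P ⊆ C, (∀ y ∈ P, ∀ s ∈ A ∪ A⁻¹, y * s ∈ C → y * s ∈ P) → (C \ P).Nonempty →
      P ∉ U := by
    intro P hP hcl ⟨q, hq, hqP⟩ hPU
    have hsub := cobd_subset_of_closed hP hcl
    have hsepP : Separates U V P :=
      ⟨thin_of_symm_gens hgen hsep.1 hsub, hPU, fun h => hsep.2.2 (Filter.mem_of_superset h hP)⟩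
    refine not_lt.2 (hmin P hsepP) (Prod.Lex.toLex_lt_toLex.2 (Or.inl ?_))
    obtain ⟨z, ⟨hz1, hz2⟩, s, hs, hzs⟩ := exists_exit hgen (C := C \ P) ⟨hq, hqP⟩ fun h => hv h.1
    have h1 : z * s ∉ P := fun h => by
      have := hcl _ h s⁻¹ (inv_mem_gens hs)
      rw [mul_inv_cancel_right] at this
      exact hz2 (this hz1)
    have h2 : z * s ∉ C := fun h => hzs ⟨h, h1⟩
    exact cutSize_lt hsep.1 (fun s hs => hsub s (by rw [← hS]; exact hs))
      ⟨s, by rw [← Finset.mem_coe, hS]; exact hs, z, by simp [mem_cobd, hz1, h2],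
        by simp [mem_cobd, hz2, h1]⟩
  intro x hx y hy
  by_contra hxy
  have hsub : component A C x ⊆ C := component_subset hx
  have h1 := key _ hsub (fun _ hy s hs => mul_mem_component hs hy) ⟨y, hy, hxy⟩
  have h2 := key (C \ component A C x) Set.sdiff_subset (fun y hy s hs hys => ⟨hys, fun h => by
    have := mul_mem_component (inv_mem_gens hs) h
    rw [mul_inv_cancel_right] at this
    exact hy.2 (this hy.1)⟩) ⟨x, hx, fun h => h.2 (mem_component_self _ _)⟩
  have h3 := Ultrafilter.compl_mem_iff_notMem.2 h1
  exact h2 (Filter.inter_mem hsep.2.1 h3)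

/-- In the presence of bottlenecks, cuts that minimize the weight have boundary of bounded
diameter, where the bound does not depend on the set of labels `B`. -/
theorem exists_wordDist_bdry_le (hgen : Subgroup.closure A = ⊤) (hA : A.Finite)
    (hB : Bottleneck A ε) {S : Finset G} (hS : (S : Set G) = A ∪ A⁻¹) :
    ∃ R, ∀ (B : Finset G), ∀ C ∈ optimalCuts S B, ∀ x ∈ bdry A C, ∀ y ∈ bdry A C,
      wordDist A x y ≤ R := by
  obtain ⟨k, hk⟩ := exists_cutSize_component_le hgen hA hS ε
  refine ⟨k * (6 * ε + 1) + 2, fun B C hC => ?_⟩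
  have hsize : cutSize S C ≤ k := by
    obtain ⟨U, V, hU, hV, hsep, hmin⟩ := hC
    obtain ⟨z, x, hx, h⟩ := exists_component_separates hgen hA hB hU hV hsep
    have h1 := hk z x hx
    have h2 := Prod.Lex.toLex_le_toLex.1 (hmin _ h)
    simp only at h2
    lia
  have hbd : bdry A C ⊆ ⋃ s ∈ S, cobd s C := fun x ⟨s, hs, hx⟩ =>
    Set.mem_biUnion (show s ∈ (S : Set G) by rw [hS]; exact hs) hx
  have hthin := thin_of_mem_optimalCuts hC
  have hfin' : (⋃ s ∈ S, cobd s C).Finite := S.finite_toSet.biUnion fun s _ => hthin s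
  have hfin : (bdry A C).Finite := hfin'.subset hbd
  have hcard : (bdry A C).ncard ≤ k :=
    (Set.ncard_le_ncard hbd hfin').trans ((Finset.set_ncard_biUnion_le _ _).trans hsize)
  have hconn := connected_of_mem_optimalCuts hgen hS hC
  have hconn' := connected_of_mem_optimalCuts hgen hS (compl_mem_optimalCuts hC)
  have near : ∀ x ∈ bdry A C, x ∈ C → ∀ y ∈ bdry A C, y ∈ C → ∀ z,
      wordDist A x z + wordDist A z y = wordDist A x y →
      ∃ c ∈ bdry A C, wordDist A z c ≤ 3 * ε := by
    intro x hx hxC y hy hyC z hz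
    obtain ⟨a, ha, hza⟩ := hB C x y z hconn hxC hyC hz
    have hlast : ∀ u ∈ bdry A C, u ∈ C → ∃ w ∈ Cᶜ, JoinedThrough A (Cᶜ ∪ {x, y}) u w ∧
        JoinedThrough A (Cᶜ ∪ {x, y}) w u ∨ u ∉ ({x, y} : Set G) := by
      rintro u ⟨s, hs, hus⟩ huC
      have hw : u * s ∉ C := fun h => hus (by simp [huC, h])
      refine ⟨u * s, hw, ?_⟩
      by_cases hu : u ∈ ({x, y} : Set G)
      · refine Or.inl ⟨Relation.ReflTransGen.single ⟨Or.inl hw, s, hs, rfl⟩,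
          Relation.ReflTransGen.single ⟨Or.inr hu, s⁻¹, inv_mem_gens hs, by simp⟩⟩
      · exact Or.inr hu
    have hc2 : CayleyConnected A (Cᶜ ∪ {x, y}) := by
      have hlift : ∀ p ∈ Cᶜ ∪ {x, y}, ∃ w ∈ Cᶜ, JoinedThrough A (Cᶜ ∪ {x, y}) p w ∧
          JoinedThrough A (Cᶜ ∪ {x, y}) w p := by
        intro p hp
        by_cases hpC : p ∈ C
        · have hp' : p ∈ ({x, y} : Set G) := hp.resolve_left fun h => h hpC
          have hpb : p ∈ bdry A C := by
            rcases hp' with rfl | rfl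
            exacts [hx, hy]
          obtain ⟨w, hw, h⟩ := hlast p hpb hpC
          exact ⟨w, hw, h.resolve_right fun h => h hp'⟩
        · exact ⟨p, hpC, Relation.ReflTransGen.refl, Relation.ReflTransGen.refl⟩
      intro p hp q hq
      obtain ⟨w, hw, hpw, -⟩ := hlift p hp
      obtain ⟨w', hw', -, hqw⟩ := hlift q hq
      exact (hpw.trans ((hconn' w hw w' hw').mono Set.subset_union_left)).trans hqw
    obtain ⟨b, hb, hzb⟩ := hB _ x y z hc2 (by simp) (by simp) hz
    by_cases hbC : b ∈ C
    · refine ⟨b, ?_, by lia⟩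
      rcases hb.resolve_left fun h => h hbC with rfl | rfl
      exacts [hx, hy]
    · obtain ⟨c, -, hc, hc'⟩ := exists_mem_bdry_between hgen ha hbC
      refine ⟨c, hc, ?_⟩
      have h1 := wordDist_triangle hgen z a c
      have h2 := wordDist_triangle hgen a z b
      have h3 := wordDist_comm hgen a z
      lia
  have hdiam : ∀ x ∈ bdry A C, x ∈ C → ∀ y ∈ bdry A C, y ∈ C →
      wordDist A x y ≤ k * (6 * ε + 1) := by
    intro x hx hxC y hy hyC
    by_contra! hlt
    obtain ⟨γ, m, hγ, rfl, rfl, -⟩ := exists_geodesic_through hgen (g := x) (z := x) (h := y)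
      (by simp)
    have h0m := hγ.wordDist_eq (Nat.zero_le m) le_rfl
    have hle : ∀ i : Fin (k + 1), (i : ℕ) * (6 * ε + 1) ≤ m := fun i => by
      have : (i : ℕ) * (6 * ε + 1) ≤ k * (6 * ε + 1) := Nat.mul_le_mul_right _ (by lia)
      lia
    have hc : ∀ i : Fin (k + 1), ∃ c ∈ bdry A C,
        wordDist A (γ ((i : ℕ) * (6 * ε + 1))) c ≤ 3 * ε := fun i => by
      refine near _ hx hxC _ hy hyC _ ?_
      rw [hγ.wordDist_eq (Nat.zero_le _) (hle i), hγ.wordDist_eq (hle i) le_rfl, h0m, Nat.sub_zero,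
        Nat.sub_zero, Nat.add_sub_cancel' (hle i)]
    choose c hc hcd using hc
    have hinj : Function.Injective fun i => (⟨c i, hc i⟩ : bdry A C) := by
      have key : ∀ i j : Fin (k + 1), i < j → c i ≠ c j := by
        intro i j hij heq
        have h1 : (i + 1 : ℕ) * (6 * ε + 1) ≤ j * (6 * ε + 1) := Nat.mul_le_mul_right _ hij
        rw [add_mul, one_mul] at h1
        have h2 := hγ.wordDist_eq (i := i * (6 * ε + 1)) ((Nat.le_add_right _ _).trans h1) (hle j)
        have h3 := wordDist_triangle hgen (γ ((i : ℕ) * (6 * ε + 1))) (c i)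
          (γ ((j : ℕ) * (6 * ε + 1)))
        have h4 := hcd i
        have h5 := hcd j
        rw [← heq, wordDist_comm hgen] at h5
        rw [h2] at h3
        generalize (i : ℕ) * (6 * ε + 1) = p at *
        generalize (j : ℕ) * (6 * ε + 1) = q at *
        omega
      intro i j hij
      have hij' : c i = c j := congrArg Subtype.val hij
      by_contra hne
      rcases lt_or_gt_of_ne hne with h | h
      exacts [key i j h hij', key j i h hij'.symm]
    have : Finite (bdry A C) := hfin
    have := Nat.card_le_card_of_injective _ hinj
    rw [Nat.card_fin, Nat.card_coe_set_eq] at this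
    lia
  have hin : ∀ x ∈ bdry A C, ∃ x' ∈ bdry A C, x' ∈ C ∧ wordDist A x x' ≤ 1 := by
    rintro x ⟨s, hs, hx⟩
    by_cases hxC : x ∈ C
    · exact ⟨x, ⟨s, hs, hx⟩, hxC, by simp⟩
    · refine ⟨x * s, mul_mem_bdry hs hx, ?_, wordDist_mul_gen_le hs x⟩
      by_contra h
      exact hx (by simp [hxC, h])
  intro x hx y hy
  obtain ⟨x', h1, h2, h3⟩ := hin x hx
  obtain ⟨y', h1', h2', h3'⟩ := hin y hy
  have h4 := hdiam x' h1 h2 y' h1' h2'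
  have h5 := wordDist_triangle hgen x x' y
  have h6 := wordDist_triangle hgen x' y' y
  have h7 := wordDist_comm hgen y' y
  lia

end BoundedCuts

section NestedCuts

variable {G : Type*} [Group G] {A : Set G}

/-- A locally finite, invariant system of nested cuts of a Cayley graph. -/
structure IsNestedCutSystem (A : Set G) (𝓔 : Set (Set G)) : Prop where
  compl_mem : ∀ C ∈ 𝓔, Cᶜ ∈ 𝓔
  smul_mem : ∀ (g : G), ∀ C ∈ 𝓔, g • C ∈ 𝓔
  nonempty : ∀ C ∈ 𝓔, C.Nonempty
  nested : ∀ C ∈ 𝓔, ∀ D ∈ 𝓔, C ⊆ D ∨ C ⊆ Dᶜ ∨ Cᶜ ⊆ D ∨ Cᶜ ⊆ Dᶜ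
  finite_separating : ∀ x y, {C ∈ 𝓔 | ¬(x ∈ C ↔ y ∈ C)}.Finite
  exists_diam_le : ∃ R, ∀ C ∈ 𝓔, ∀ x ∈ bdry A C, ∀ y ∈ bdry A C, wordDist A x y ≤ R
  finite_bdry : ∀ C ∈ 𝓔, (bdry A C).Finite

theorem exists_mem_bdry_of_connected {C Y : Set G} (hY : CayleyConnected A Y)
    (h1 : (Y ∩ C).Nonempty) (h2 : (Y ∩ Cᶜ).Nonempty) :
    (∃ p ∈ bdry A C, p ∈ Y ∧ p ∈ C) ∧ ∃ q ∈ bdry A C, q ∈ Y ∧ q ∉ C := by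
  by_cases h : ∀ x ∈ Y ∩ C, ∀ s ∈ A ∪ A⁻¹, x * s ∈ Y → x * s ∈ Y ∩ C
  · have := hY.eq_of_closed Set.inter_subset_left h1 h
    obtain ⟨q, hq, hqC⟩ := h2
    rw [← this] at hq
    exact absurd hq.2 hqC
  · push Not at h
    obtain ⟨x, ⟨hx, hxC⟩, s, hs, hxs, hxsC⟩ := h
    have hxsC' : x * s ∉ C := fun h => hxsC ⟨hxs, h⟩
    have hb : x ∈ cobd s C := by simp [mem_cobd, hxC, hxsC']
    exact ⟨⟨x, ⟨s, hs, hb⟩, hx, hxC⟩, x * s, mul_mem_bdry hs hb, hxs, hxsC'⟩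

theorem corner_weights_contradiction {M : Type*} [AddCommMonoid M] [LinearOrder M]
    [IsOrderedCancelAddMonoid M] {c d p q r s : M} (h1 : p + s < c + d) (h2 : q + r < c + d)
    {dU dV cU cV : Prop} (hp : dU → c ≤ p) (hp' : cU → d ≤ p) (hq : ¬dU → c ≤ q)
    (hq' : cV → d ≤ q) (hr : dV → c ≤ r) (hr' : ¬cU → d ≤ r) (hs : ¬dV → c ≤ s)
    (hs' : ¬cV → d ≤ s) : False := by
  have key : ∀ {a b : M}, c ≤ a → d ≤ b → a + b < c + d → False := fun ha hb h =>
    not_lt.2 (add_le_add ha hb) h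
  have key2 : ∀ {a a' b b' : M}, c ≤ a → c ≤ a' → d ≤ b → d ≤ b' →
      a + a' < c + d → b + b' < c + d → False := fun ha ha' hb hb' h h' => by
    have := add_lt_add h h'
    rw [add_add_add_comm c d c d] at this
    exact not_lt.2 (add_le_add (add_le_add ha ha') (add_le_add hb hb')) this
  by_cases u : dU <;> by_cases u' : cU <;> by_cases v : dV <;> by_cases v' : cV
  all_goals
    first
    | exact key (hp u) (hs' v') h1
    | exact key (hs v) (hp' u') (by rwa [add_comm])
    | exact key (hq u) (hr' u') h2
    | exact key (hr v) (hq' v') (by rwa [add_comm])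
    | exact key2 (hp u) (hs v) (hq' v') (hr' u') h1 h2
    | exact key2 (hq u) (hr v) (hp' u') (hs' v') h2 h1

theorem optimalCuts_nested (hgen : Subgroup.closure A = ⊤) {S B : Finset G}
    (hS : (S : Set G) = A ∪ A⁻¹) {C D : Set G} (hC : C ∈ optimalCuts S B)
    (hD : D ∈ optimalCuts S B)
    (hdiam : ∀ x ∈ bdry A C, ∀ y ∈ bdry A C, x⁻¹ * y ∈ B) :
    C ⊆ D ∨ C ⊆ Dᶜ ∨ Cᶜ ⊆ D ∨ Cᶜ ⊆ Dᶜ := by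
  by_contra hne
  simp only [not_or, Set.not_subset] at hne
  obtain ⟨⟨q₀, hq₁, hq₂⟩, ⟨p₀, hp₁, hp₂⟩, ⟨s₀, hs₁, hs₂⟩, ⟨r₀, hr₁, hr₂⟩⟩ := hne
  simp only [Set.notMem_compl_iff] at hp₂ hr₂
  obtain ⟨⟨p, hp, hpD, hpC⟩, r, hr, hrD, hrC⟩ := exists_mem_bdry_of_connected
    (connected_of_mem_optimalCuts hgen hS hD) ⟨p₀, hp₂, hp₁⟩ ⟨r₀, hr₂, hr₁⟩
  obtain ⟨⟨q, hq, hqD, hqC⟩, s, hs, hsD, hsC⟩ := exists_mem_bdry_of_connected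
    (connected_of_mem_optimalCuts hgen hS (compl_mem_optimalCuts hD)) ⟨q₀, hq₂, hq₁⟩ ⟨s₀, hs₂, hs₁⟩
  have tC := thin_of_mem_optimalCuts hC
  have tD := thin_of_mem_optimalCuts hD
  have h1 := cutWeight_inter_add_union_lt tC tD (S := S) (B := B)
    ⟨q⁻¹ * r, hdiam q hq r hr, q, ⟨hqC, hqD⟩, by simpa using ⟨hrD, hrC⟩⟩
  have h2 := cutWeight_inter_add_union_lt tC tD.compl (S := S) (B := B)
    ⟨p⁻¹ * s, hdiam p hp s hs, p, ⟨hpC, by simpa⟩, by simpa using ⟨hsD, hsC⟩⟩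
  rw [← cutWeight_compl _ _ (C ∪ D), Set.compl_union] at h1
  rw [← cutWeight_compl _ _ (C ∪ Dᶜ), Set.compl_union, compl_compl, cutWeight_compl _ _ D] at h2
  have opt : ∀ {U V : Ultrafilter G} {E : Set G},
      (∀ X, Separates U V X → cutWeight S B E ≤ cutWeight S B X) → ∀ X, Thin X →
      (X ∈ U ↔ X ∉ V) → cutWeight S B E ≤ cutWeight S B X := by
    intro U V E hE X tX hX
    by_cases hU : X ∈ U
    · exact hE X ⟨tX, hU, hX.1 hU⟩
    · rw [← cutWeight_compl S B X]
      refine hE Xᶜ (Separates.compl ⟨tX, ?_, hU⟩)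
      by_contra h
      exact hU (hX.2 h)
  obtain ⟨U, V, -, -, ⟨-, hU, hV⟩, hminC⟩ := hC
  obtain ⟨U', V', -, -, ⟨-, hU', hV'⟩, hminD⟩ := hD
  have memi : ∀ (W : Ultrafilter G) (X Y : Set G), X ∩ Y ∈ W ↔ X ∈ W ∧ Y ∈ W := fun W X Y =>
    Filter.inter_mem_iff
  refine corner_weights_contradiction h1 h2 (dU := D ∈ U) (dV := D ∈ V) (cU := C ∈ U')
    (cV := C ∈ V') ?_ ?_ ?_ ?_ ?_ ?_ ?_ ?_
  · exact fun h => opt hminC _ (tC.inter tD) (by simp [*])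
  · exact fun h => opt hminD _ (tC.inter tD) (by simp [*])
  · exact fun h => opt hminC _ (tC.inter tD.compl) (by
      simp [Ultrafilter.compl_mem_iff_notMem, *])
  · exact fun h => opt hminD _ (tC.inter tD.compl) (by
      simp [Ultrafilter.compl_mem_iff_notMem, *])
  · exact fun h => opt hminC _ (tC.compl.inter tD) (by
      simp [Ultrafilter.compl_mem_iff_notMem, *])
  · exact fun h => opt hminD _ (tC.compl.inter tD) (by
      simp [Ultrafilter.compl_mem_iff_notMem, *])
  · exact fun h => opt hminC _ (tC.compl.inter tD.compl) (by
      simp [Ultrafilter.compl_mem_iff_notMem, *])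
  · exact fun h => opt hminD _ (tC.compl.inter tD.compl) (by
      simp [Ultrafilter.compl_mem_iff_notMem, *])

/-- Sets with boundaries of bounded diameter that separate two given points form a finite family. -/
theorem finite_separating_of_diam_le (hgen : Subgroup.closure A = ⊤) (hA : A.Finite)
    {𝓔 : Set (Set G)} {R : ℕ}
    (hR : ∀ C ∈ 𝓔, ∀ x ∈ bdry A C, ∀ y ∈ bdry A C, wordDist A x y ≤ R) (x y : G) :
    {C ∈ 𝓔 | ¬(x ∈ C ↔ y ∈ C)}.Finite := by
  have hstep : ∀ x, ∀ s ∈ A ∪ A⁻¹, {C ∈ 𝓔 | ¬(x ∈ C ↔ x * s ∈ C)}.Finite := by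
    intro x s hs
    let N : Set G := {h | wordDist A x h ≤ R}
    have hN : N.Finite := finite_ball hgen hA x R
    refine Set.Finite.of_injOn (f := fun C => C ∩ N) (t := 𝒫 N)
      (fun C _ => Set.inter_subset_right) ?_ hN.powerset
    have main : ∀ C ∈ 𝓔, x ∈ cobd s C → ∀ D ∈ 𝓔, x ∈ cobd s D → C ∩ N = D ∩ N → ∀ t ∈ A ∪ A⁻¹,
        cobd t C ⊆ cobd t D := by
      intro C hC hxC D hD hxD heq t ht z hz
      have h1 : z ∈ N := hR C hC x ⟨s, hs, hxC⟩ z ⟨t, ht, hz⟩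
      have h2 : z * t ∈ N := hR C hC x ⟨s, hs, hxC⟩ _ (mul_mem_bdry ht hz)
      have h3 := Set.ext_iff.1 heq z
      have h4 := Set.ext_iff.1 heq (z * t)
      simp only [Set.mem_inter_iff, h1, h2, and_true] at h3 h4
      rw [mem_cobd] at hz ⊢
      rwa [← h3, ← h4]
    rintro C ⟨hC, hxC⟩ D ⟨hD, hxD⟩ heq
    have hxN : x ∈ N := by simp [N]
    ext z
    refine eq_univ_of_mul_mem hgen (C := {z | z ∈ C ↔ z ∈ D}) ⟨x, ?_⟩ (fun z hz t ht => ?_) z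
    · have := Set.ext_iff.1 heq x
      simpa [hxN] using this
    · have h1 := @main C hC hxC D hD hxD heq t ht z
      have h2 := @main D hD hxD C hC hxC heq.symm t ht z
      simp only [mem_cobd, Set.mem_ofPred_eq] at *
      tauto
  refine eq_univ_of_mul_mem hgen (C := {y | {C ∈ 𝓔 | ¬(x ∈ C ↔ y ∈ C)}.Finite}) ⟨x, by simp⟩
    (fun y hy s hs => (hy.union (hstep y s hs)).subset ?_) y
  rintro C ⟨hC, h⟩
  simp only [Set.mem_union, Set.mem_ofPred_eq, hC, true_and]
  tauto

/-- The Cayley graph of a group with bottlenecks has an invariant nested system of cuts that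
separates any two ends. -/
theorem exists_isNestedCutSystem (hgen : Subgroup.closure A = ⊤) (hA : A.Finite) {ε : ℕ}
    (hB : Bottleneck A ε) : ∃ 𝓔, IsNestedCutSystem A 𝓔 ∧
      ∀ U V : Ultrafilter G, (U : Filter G) ≤ Filter.cofinite → (V : Filter G) ≤ Filter.cofinite →
        (∃ C, Separates U V C) → ∃ C ∈ 𝓔, Separates U V C := by
  classical
  have hSfin := hA.union hA.inv
  have hS : ((hSfin.toFinset : Finset G) : Set G) = A ∪ A⁻¹ := by simp
  obtain ⟨R, hR⟩ := exists_wordDist_bdry_le hgen hA hB hS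
  have hball := finite_ball hgen hA 1 R
  refine ⟨optimalCuts hSfin.toFinset hball.toFinset, ⟨fun C hC => compl_mem_optimalCuts hC,
    fun g C hC => smul_mem_optimalCuts hC g, fun C hC => nonempty_of_mem_optimalCuts hC,
    fun C hC D hD => optimalCuts_nested hgen hS hC hD fun x hx y hy => ?_,
    finite_separating_of_diam_le hgen hA (hR _), ⟨R, hR _⟩, fun C hC => ?_⟩,
    fun U V hU hV h => exists_optimalCut hU hV h⟩
  · rw [Set.Finite.mem_toFinset, Set.mem_ofPred_eq, ← wordDist_mul_left x, mul_one,
      mul_inv_cancel_left]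
    exact hR _ C hC x hx y hy
  · exact (hSfin.biUnion fun s _ => thin_of_mem_optimalCuts hC s).subset
      fun x ⟨s, hs, hx⟩ => Set.mem_biUnion hs hx

end NestedCuts

section Orientations

variable {G : Type*}

/-- The orientation obtained from `v` by reversing the cut `C`. -/
def flipCut (v : Set (Set G)) (C : Set G) : Set (Set G) := insert Cᶜ (v \ {C})

theorem mem_flipCut {v : Set (Set G)} {C X : Set G} :
    X ∈ flipCut v C ↔ X = Cᶜ ∨ X ∈ v ∧ X ≠ C := Iff.rfl

variable [Group G] {A : Set G} {𝓔 : Set (Set G)}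

/-- A consistent choice of a side of every cut, agreeing with the sides that contain `1` up to
finitely many exceptions. -/
structure IsOrientation (𝓔 v : Set (Set G)) : Prop where
  subset : v ⊆ 𝓔
  compl_mem_iff : ∀ X ∈ 𝓔, (Xᶜ ∈ v ↔ X ∉ v)
  mono : ∀ X ∈ v, ∀ Y ∈ 𝓔, X ⊆ Y → Y ∈ v
  finite : {X ∈ v | 1 ∉ X}.Finite

/-- The orientation of the cuts towards `g`. -/
def orientationAt (𝓔 : Set (Set G)) (g : G) : Set (Set G) := {X ∈ 𝓔 | g ∈ X}

theorem smul_flipCut (g : G) (v : Set (Set G)) (C : Set G) :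
    g • flipCut v C = flipCut (g • v) (g • C) := by
  ext X
  rw [Set.mem_smul_set_iff_inv_smul_mem, mem_flipCut, mem_flipCut,
    Set.mem_smul_set_iff_inv_smul_mem, inv_smul_eq_iff, Set.smul_set_compl, ne_eq, ne_eq,
    inv_smul_eq_iff]

theorem minimal_smul {v : Set (Set G)} {C : Set G} (hC : Minimal (· ∈ v) C) (g : G) :
    Minimal (· ∈ g • v) (g • C) := by
  refine ⟨Set.smul_mem_smul_set hC.1, fun X hX hXC => ?_⟩
  exact Set.smul_set_subset_iff_subset_inv_smul_set.2
    (hC.2 (Set.mem_smul_set_iff_inv_smul_mem.1 hX) (by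
      rwa [Set.smul_set_subset_iff_subset_inv_smul_set, inv_inv]))

theorem isOrientation_orientationAt (h : IsNestedCutSystem A 𝓔) (g : G) :
    IsOrientation 𝓔 (orientationAt 𝓔 g) where
  subset := fun X hX => hX.1
  compl_mem_iff X hX := by simp [orientationAt, hX, h.compl_mem X hX]
  mono X hX Y hY hXY := ⟨hY, hXY hX.2⟩
  finite := (h.finite_separating g 1).subset fun X hX => ⟨hX.1.1, by
    have := hX.1.2; have := hX.2; tauto⟩

namespace IsOrientation

variable {v u : Set (Set G)}

theorem not_subset_compl (hv : IsOrientation 𝓔 v) (h : IsNestedCutSystem A 𝓔) {X Y : Set G}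
    (hX : X ∈ v) (hY : Y ∈ v) : ¬ X ⊆ Yᶜ := fun hXY =>
  (hv.compl_mem_iff Y (hv.subset hY)).1 (hv.mono X hX _ (h.compl_mem _ (hv.subset hY)) hXY) hY

theorem finite_at (hv : IsOrientation 𝓔 v) (h : IsNestedCutSystem A 𝓔) (g : G) :
    {X ∈ v | g ∉ X}.Finite := by
  refine (hv.finite.union (h.finite_separating g 1)).subset fun X hX => ?_
  by_cases h1 : 1 ∈ X
  · exact Or.inr ⟨hv.subset hX.1, by have := hX.2; tauto⟩
  · exact Or.inl ⟨hX.1, h1⟩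

theorem smul (hv : IsOrientation 𝓔 v) (h : IsNestedCutSystem A 𝓔) (g : G) :
    IsOrientation 𝓔 (g • v) where
  subset X hX := by
    rw [Set.mem_smul_set_iff_inv_smul_mem] at hX
    simpa using h.smul_mem g _ (hv.subset hX)
  compl_mem_iff X hX := by
    rw [Set.mem_smul_set_iff_inv_smul_mem, Set.mem_smul_set_iff_inv_smul_mem, Set.smul_set_compl,
      hv.compl_mem_iff _ (h.smul_mem _ _ hX)]
  mono X hX Y hY hXY := by
    rw [Set.mem_smul_set_iff_inv_smul_mem] at hX ⊢
    exact hv.mono _ hX _ (h.smul_mem _ _ hY) (Set.smul_set_mono hXY)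
  finite := by
    refine ((hv.finite_at h g⁻¹).image (g • ·)).subset fun X hX => ⟨g⁻¹ • X, ⟨?_, ?_⟩, by simp⟩
    · exact Set.mem_smul_set_iff_inv_smul_mem.1 hX.1
    · intro hg
      rw [Set.mem_smul_set_iff_inv_smul_mem] at hg
      simp at hg
      exact hX.2 hg

theorem eq_of_subset (hv : IsOrientation 𝓔 v) (hu : IsOrientation 𝓔 u) (huv : u ⊆ v) : u = v := by
  refine huv.antisymm fun X hX => ?_
  by_contra hXu
  exact (hv.compl_mem_iff X (hv.subset hX)).1
    (huv ((hu.compl_mem_iff X (hv.subset hX)).2 hXu)) hX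

theorem exists_minimal_le (hv : IsOrientation 𝓔 v) (h : IsNestedCutSystem A 𝓔) {X : Set G}
    (hX : X ∈ v) : ∃ M ⊆ X, Minimal (· ∈ v) M := by
  obtain ⟨g, hg⟩ := h.nonempty _ (h.compl_mem _ (hv.subset hX))
  obtain ⟨M, hMX, hM⟩ := (hv.finite_at h g).exists_le_minimal (a := X) ⟨hX, hg⟩
  exact ⟨M, hMX, hM.1.1, fun Y hY hYM => hM.2 ⟨hY, fun hgY => hM.1.2 (hYM hgY)⟩ hYM⟩

theorem eq_of_minimal (hv : IsOrientation 𝓔 v) (hu : IsOrientation 𝓔 u)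
    (h : IsNestedCutSystem A 𝓔) {M : Set G} (hMv : Minimal (· ∈ v) M)
    (hMu : Minimal (· ∈ u) M) : u = v := by
  refine hv.eq_of_subset hu fun Y hY => ?_
  have hY' := hu.subset hY
  rcases h.nested M (hv.subset hMv.1) Y hY' with hMY | hMY | hMY | hMY
  · exact hv.mono M hMv.1 Y hY' hMY
  · exact absurd hMY (hu.not_subset_compl h hMu.1 hY)
  · by_contra hYv
    have h1 := hMv.eq_of_subset ((hv.compl_mem_iff Y hY').2 hYv) (Set.compl_subset_comm.1 hMY)
    exact hu.not_subset_compl h hMu.1 hY (by rw [h1])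
  · rw [hMu.eq_of_subset hY (Set.compl_subset_compl.1 hMY)]
    exact hMv.1

theorem flipCut (hv : IsOrientation 𝓔 v) (h : IsNestedCutSystem A 𝓔) {C : Set G}
    (hC : Minimal (· ∈ v) C) : IsOrientation 𝓔 (flipCut v C) := by
  have hCE := hv.subset hC.1
  have hne : ¬ Cᶜ ⊆ C := fun hCC => hv.not_subset_compl h hC.1 hC.1 (by
    obtain ⟨x, hx⟩ := h.nonempty _ (h.compl_mem _ hCE)
    exact absurd (hCC hx) hx)
  refine ⟨?_, fun X hX => ?_, fun X hX Y hY hXY => ?_, ?_⟩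
  · rintro X (rfl | hX)
    · exact h.compl_mem _ hCE
    · exact hv.subset hX.1
  · have h1 := hv.compl_mem_iff X hX
    simp only [mem_flipCut, compl_inj_iff, ne_eq]
    by_cases h2 : X = C
    · subst h2
      have : X ≠ Xᶜ := fun h => hne h.ge
      simp [this]
    · by_cases h3 : X = Cᶜ
      · subst h3; simp [h2]
      · have : Xᶜ ≠ C := fun h => h3 (by rw [← h, compl_compl])
        simp [h1, h2, h3, this]
  · rw [mem_flipCut]
    rcases hX with rfl | ⟨hX, hXC⟩
    · by_cases h1 : Y = Cᶜ
      · exact Or.inl h1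
      · refine Or.inr ⟨?_, fun h2 => hne (h2 ▸ hXY)⟩
        by_contra hYv
        have := hC.eq_of_subset ((hv.compl_mem_iff Y hY).2 hYv) (Set.compl_subset_comm.1 hXY)
        exact h1 (by rw [← this, compl_compl])
    · refine Or.inr ⟨hv.mono X hX Y hY hXY, ?_⟩
      rintro rfl
      exact hXC (hC.eq_of_subset hX hXY)
  · refine (hv.finite.insert Cᶜ).subset ?_
    rintro X ⟨rfl | hX, h1⟩
    · exact Or.inl rfl
    · exact Or.inr ⟨hX.1, h1⟩

theorem minimal_flipCut (hv : IsOrientation 𝓔 v) (h : IsNestedCutSystem A 𝓔) {C : Set G}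
    (hC : Minimal (· ∈ v) C) : Minimal (· ∈ _root_.flipCut v C) Cᶜ := by
  refine ⟨Or.inl rfl, ?_⟩
  rintro X (rfl | hX) hXC
  · exact le_rfl
  · exact absurd hXC (hv.not_subset_compl h hX.1 hC.1)

theorem flipCut_flipCut (hv : IsOrientation 𝓔 v) {C : Set G} (hC : C ∈ v) :
    _root_.flipCut (_root_.flipCut v C) Cᶜ = v := by
  have h1 : Cᶜ ∉ v := fun h => (hv.compl_mem_iff C (hv.subset hC)).1 h hC
  ext X
  simp only [mem_flipCut, compl_compl, ne_eq]
  by_cases h2 : X = C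
  · simp [h2, hC]
  · by_cases h3 : X = Cᶜ
    · simp [h3, h1]
    · simp [h2, h3]

theorem eq_orientationAt (hv : IsOrientation 𝓔 v) (h : IsNestedCutSystem A 𝓔) {g : G}
    (hg : ∀ X ∈ v, g ∈ X) : v = orientationAt 𝓔 g :=
  (isOrientation_orientationAt h g).eq_of_subset hv fun X hX => ⟨hv.subset hX, hg X hX⟩

theorem exists_least (hv : IsOrientation 𝓔 v) (h : IsNestedCutSystem A 𝓔)
    (h1 : v ≠ orientationAt 𝓔 1) :
    ∃ C, 1 ∉ C ∧ Minimal (· ∈ v) C ∧ ∀ X ∈ v, 1 ∉ X → C ⊆ X := by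
  have h2 : ∃ X ∈ v, 1 ∉ X := by
    by_contra! h2
    exact h1 (hv.eq_orientationAt h h2)
  obtain ⟨Y, hY, hY1⟩ := h2
  obtain ⟨C, hCY, hC⟩ := hv.exists_minimal_le h hY
  have hC1 : 1 ∉ C := fun h => hY1 (hCY h)
  refine ⟨C, hC1, hC, fun X hX hX1 => ?_⟩
  rcases h.nested C (hv.subset hC.1) X (hv.subset hX) with h3 | h3 | h3 | h3
  · exact h3
  · exact absurd h3 (hv.not_subset_compl h hC.1 hX)
  · exact absurd (h3 hC1) hX1
  · exact (hC.eq_of_subset hX (Set.compl_subset_compl.1 h3)).ge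

end IsOrientation

/-- The orientations of a nested system of cuts. -/
def orientations (h : IsNestedCutSystem A 𝓔) : SubMulAction G (Set (Set G)) where
  carrier := {v | IsOrientation 𝓔 v}
  smul_mem' g _ hv := IsOrientation.smul hv h g

/-- The orientations of a nested system of cuts are the vertices of a tree. -/
theorem exists_orientationTree (h : IsNestedCutSystem A 𝓔) :
    ∃ T : ParentTree (orientations h), ∀ (g : G) u v, T.Adj u v → T.Adj (g • u) (g • v) := by
  classical
  let root : orientations h := ⟨orientationAt 𝓔 1, isOrientation_orientationAt h 1⟩
  have hpar : ∀ v : orientations h, ∃ w : orientations h, v ≠ root →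
      ∃ C, 1 ∉ C ∧ Minimal (· ∈ v.1) C ∧ (∀ X ∈ v.1, 1 ∉ X → C ⊆ X) ∧ w.1 = flipCut v.1 C := by
    intro v
    by_cases hvr : v = root
    · exact ⟨v, fun h => absurd hvr h⟩
    · obtain ⟨C, h1, h2, h3⟩ := v.2.exists_least h fun h' => hvr (Subtype.ext h')
      exact ⟨⟨flipCut v.1 C, v.2.flipCut h h2⟩, fun _ => ⟨C, h1, h2, h3, rfl⟩⟩
  choose par hpar using hpar
  have hdr : {X ∈ root.1 | 1 ∉ X} = ∅ := by
    ext X; simp only [Set.mem_ofPred_eq, Set.mem_empty_iff_false, iff_false, not_and, not_not]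
    exact fun hX => hX.2
  let T : ParentTree (orientations h) :=
    { root := root
      parent := par
      depth := fun v => {X ∈ v.1 | 1 ∉ X}.ncard
      depth_root := by rw [hdr, Set.ncard_empty]
      depth_eq := fun v hv => by
        obtain ⟨C, h1, h2, -, h4⟩ := hpar v hv
        have : {X ∈ v.1 | 1 ∉ X} = insert C {X ∈ (par v).1 | 1 ∉ X} := by
          ext X
          simp only [h4, Set.mem_ofPred_eq, Set.mem_insert_iff, mem_flipCut]
          by_cases hX : X = C
          · simp [hX, h1, h2.1]
          · by_cases hX' : X = Cᶜ
            · simp [hX', h1]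
            · simp [hX, hX']
        rw [this, Set.ncard_insert_of_notMem _ (par v).2.finite]
        rw [h4]
        rintro ⟨hC | hC, -⟩
        · have := v.2.not_subset_compl h h2.1 h2.1
          exact this hC.le
        · exact hC.2 rfl }
  have hadj : ∀ u v, T.Adj u v ↔ ∃ C, Minimal (· ∈ u.1) C ∧ v.1 = flipCut u.1 C := by
    intro u v
    constructor
    · rintro (⟨hu, rfl⟩ | ⟨hv, rfl⟩)
      · obtain ⟨C, -, h2, -, h4⟩ := hpar u hu
        exact ⟨C, h2, h4⟩
      · obtain ⟨C, -, h2, -, h4⟩ := hpar v hv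
        change ∃ D, Minimal (· ∈ (par v).1) D ∧ v.1 = flipCut (par v).1 D
        exact ⟨Cᶜ, by rw [h4]; exact v.2.minimal_flipCut h h2, by
          rw [h4, v.2.flipCut_flipCut h2.1]⟩
    · have key : ∀ (u v : orientations h) (C : Set G), Minimal (· ∈ u.1) C →
          v.1 = flipCut u.1 C → 1 ∉ C → u ≠ root ∧ v = par u := by
        intro u v C hC hvC hC1
        have hu : u ≠ root := by
          rintro rfl
          exact hC1 hC.1.2
        obtain ⟨D, -, h2, h3, h4⟩ := hpar u hu
        rw [← hC.eq_of_subset h2.1 (h3 C hC.1 hC1)] at hvC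
        exact ⟨hu, Subtype.ext (hvC.trans h4.symm)⟩
      rintro ⟨C, hC, hvC⟩
      by_cases hC1 : 1 ∈ C
      · refine Or.inr (key v u Cᶜ ?_ ?_ (by simpa using hC1))
        · rw [hvC]; exact u.2.minimal_flipCut h hC
        · rw [hvC, u.2.flipCut_flipCut hC.1]
      · exact Or.inl (key u v C hC hvC hC1)
  refine ⟨T, fun g u v huv => ?_⟩
  obtain ⟨C, hC, hvC⟩ := (hadj u v).1 huv
  refine (hadj _ _).2 ⟨g • C, minimal_smul hC g, ?_⟩
  rw [SubMulAction.val_smul, SubMulAction.val_smul, hvC, smul_flipCut]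

end Orientations

section Stabilizers

variable {G : Type*} [Group G] {A : Set G} {𝓔 v : Set (Set G)}

/-- The points of the Cayley graph adjacent to the vertex `v` of the tree of orientations. -/
def nearPoints (A : Set G) (𝓔 v : Set (Set G)) : Set G :=
  {y | v = orientationAt 𝓔 y ∨ ∃ M, Minimal (· ∈ v) M ∧ y ∉ M ∧ ∃ s ∈ A ∪ A⁻¹, y * s ∈ M}

theorem smul_orientationAt (h : IsNestedCutSystem A 𝓔) (g y : G) :
    g • orientationAt 𝓔 y = orientationAt 𝓔 (g * y) := by
  ext X
  rw [Set.mem_smul_set_iff_inv_smul_mem]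
  simp only [orientationAt, Set.mem_ofPred_eq]
  refine and_congr ⟨fun hX => by simpa using h.smul_mem g _ hX, h.smul_mem _ _⟩ ?_
  rw [Set.mem_inv_smul_set_iff, smul_eq_mul]

theorem mul_mem_nearPoints (h : IsNestedCutSystem A 𝓔) {y : G} (hy : y ∈ nearPoints A 𝓔 v) (g : G) :
    g * y ∈ nearPoints A 𝓔 (g • v) := by
  rcases hy with rfl | ⟨M, hM, hyM, s, hs, hysM⟩
  · exact Or.inl (smul_orientationAt h g y)
  · refine Or.inr ⟨g • M, minimal_smul hM g, ?_, s, hs, ?_⟩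
    · rwa [← smul_eq_mul, Set.smul_mem_smul_set_iff]
    · rwa [mul_assoc, ← smul_eq_mul, Set.smul_mem_smul_set_iff]

theorem finite_one_mem_nearPoints (h : IsNestedCutSystem A 𝓔) (hA : A.Finite) :
    {v | IsOrientation 𝓔 v ∧ 1 ∈ nearPoints A 𝓔 v}.Finite := by
  have hfin : (⋃ s ∈ A ∪ A⁻¹, {C ∈ 𝓔 | ¬(1 ∈ C ↔ s ∈ C)}).Finite :=
    (hA.union hA.inv).biUnion fun s _ => h.finite_separating 1 s
  have hsub : ∀ M : Set G, {v | IsOrientation 𝓔 v ∧ Minimal (· ∈ v) M}.Subsingleton :=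
    fun M u hu v hv => hv.1.eq_of_minimal hu.1 h hv.2 hu.2
  refine ((hfin.biUnion fun M _ => (hsub M).finite).insert (orientationAt 𝓔 1)).subset ?_
  rintro v ⟨hv, rfl | ⟨M, hM, h1, s, hs, hsM⟩⟩
  · exact Or.inl rfl
  · rw [one_mul] at hsM
    exact Or.inr (Set.mem_biUnion (Set.mem_biUnion hs ⟨hv.subset hM.1, by tauto⟩) ⟨hv, hM⟩)

theorem nearPoints_nonempty (hgen : Subgroup.closure A = ⊤) (h : IsNestedCutSystem A 𝓔)
    (hv : IsOrientation 𝓔 v) : (nearPoints A 𝓔 v).Nonempty := by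
  by_cases h1 : v = orientationAt 𝓔 1
  · exact ⟨1, Or.inl h1⟩
  obtain ⟨C, hC1, hC, -⟩ := hv.exists_least h h1
  obtain ⟨x, hx⟩ := h.nonempty C (hv.subset hC.1)
  obtain ⟨z, hz, s, hs, hzs⟩ := exists_exit hgen (C := Cᶜ) (x := 1) (y := x) hC1 (by simpa using hx)
  exact ⟨z, Or.inr ⟨C, hC, hz, s, hs, by simpa using hzs⟩⟩

theorem mem_bdry_of_mem_nearPoints (h : IsNestedCutSystem A 𝓔) (hv : IsOrientation 𝓔 v)
    {M : Set G} (hM : Minimal (· ∈ v) M) {y : G} (hy : y ∈ nearPoints A 𝓔 v) (hyM : y ∉ M) :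
    y ∈ bdry A M := by
  rcases hy with rfl | ⟨M', hM', hyM', s, hs, hysM⟩
  · exact absurd hM.1.2 hyM
  · have : M = M' := by
      rcases h.nested M (hv.subset hM.1) M' (hv.subset hM'.1) with h1 | h1 | h1 | h1
      · exact hM'.eq_of_subset hM.1 h1
      · exact absurd h1 (hv.not_subset_compl h hM.1 hM'.1)
      · exact absurd (h1 hyM) hyM'
      · exact (hM.eq_of_subset hM'.1 (Set.compl_subset_compl.1 h1)).symm
    subst this
    exact ⟨s, hs, by simp [mem_cobd, hyM, hysM]⟩

theorem exists_nearPoint_between (hgen : Subgroup.closure A = ⊤) (h : IsNestedCutSystem A 𝓔)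
    (hv : IsOrientation 𝓔 v) {M : Set G} (hM : Minimal (· ∈ v) M) {y z : G}
    (hy : y ∈ nearPoints A 𝓔 v) (hz : z ∉ M) :
    ∃ p ∈ nearPoints A 𝓔 v, p ∈ bdry A M ∧ wordDist A z p + wordDist A p y = wordDist A z y := by
  by_cases hyM : y ∈ M
  · obtain ⟨p, hpM, ⟨s, hs, hps⟩, hp⟩ :=
      exists_mem_bdry_between hgen (C := Mᶜ) (x := z) (y := y) hz (by simpa using hyM)
    rw [cobd_compl] at hps
    refine ⟨p, Or.inr ⟨M, hM, hpM, s, hs, ?_⟩, ⟨s, hs, hps⟩, hp⟩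
    by_contra hpsM
    exact hps (by simp [hpsM, show p ∉ M from hpM])
  · exact ⟨y, hy, mem_bdry_of_mem_nearPoints h hv hM hy hyM, by simp⟩

/-- Geodesics between points adjacent to a vertex stay close to the points adjacent to it. -/
theorem exists_nearPoint_wordDist_le (hgen : Subgroup.closure A = ⊤) (h : IsNestedCutSystem A 𝓔)
    {R : ℕ} (hR : ∀ C ∈ 𝓔, ∀ x ∈ bdry A C, ∀ y ∈ bdry A C, wordDist A x y ≤ R)
    (hv : IsOrientation 𝓔 v) {x y z : G} (hx : x ∈ nearPoints A 𝓔 v) (hy : y ∈ nearPoints A 𝓔 v)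
    (hz : wordDist A x z + wordDist A z y = wordDist A x y) :
    ∃ p ∈ nearPoints A 𝓔 v, wordDist A z p ≤ R := by
  by_cases h1 : ∀ X ∈ v, z ∈ X
  · exact ⟨z, Or.inl (hv.eq_orientationAt h h1), by simp⟩
  push Not at h1
  obtain ⟨X, hX, hzX⟩ := h1
  obtain ⟨M, hMX, hM⟩ := hv.exists_minimal_le h hX
  have hzM : z ∉ M := fun h => hzX (hMX h)
  obtain ⟨p, hp, hpb, hpd⟩ := exists_nearPoint_between hgen h hv hM hx hzM
  obtain ⟨q, hq, hqb, hqd⟩ := exists_nearPoint_between hgen h hv hM hy hzM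
  refine ⟨p, hp, ?_⟩
  have h2 := hR M (hv.subset hM.1) p hpb q hqb
  have h3 := wordDist_triangle hgen x p y
  have h4 := wordDist_triangle hgen p q y
  rw [wordDist_comm hgen x z] at hz
  rw [wordDist_comm hgen p x] at hpd
  lia

/-- An orientation induces the same orientation on cuts separating two nonprincipal ultrafilters
containing the set of points adjacent to it. -/
theorem not_separates_of_nearPoints_mem (h : IsNestedCutSystem A 𝓔) (hv : IsOrientation 𝓔 v)
    {U V : Ultrafilter G} (hU : (U : Filter G) ≤ Filter.cofinite)
    (hV : (V : Filter G) ≤ Filter.cofinite) (hUv : nearPoints A 𝓔 v ∈ U)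
    (hVv : nearPoints A 𝓔 v ∈ V) {C : Set G} (hC : C ∈ 𝓔) : ¬ Separates U V C := by
  rintro ⟨-, hCU, hCV⟩
  have key : ∀ {W : Ultrafilter G} {D : Set G}, (W : Filter G) ≤ Filter.cofinite →
      nearPoints A 𝓔 v ∈ W → Dᶜ ∈ W → D ∉ v := by
    intro W D hW hWv hDW hDv
    obtain ⟨M, hMD, hM⟩ := hv.exists_minimal_le h hDv
    have h1 : (nearPoints A 𝓔 v ∩ Dᶜ).Finite :=
      (h.finite_bdry M (hv.subset hM.1)).subset fun y hy =>
        mem_bdry_of_mem_nearPoints h hv hM hy.1 fun hyM => hy.2 (hMD hyM)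
    exact Ultrafilter.compl_notMem_iff.2 (Filter.inter_mem hWv hDW) (hW h1.compl_mem_cofinite)
  by_cases hCv : C ∈ v
  · exact key hV hVv (Ultrafilter.compl_mem_iff_notMem.2 hCV) hCv
  · exact key hU hUv (by rwa [compl_compl]) ((hv.compl_mem_iff C hC).2 hCv)

theorem wordDist_one_inv_mul (g h : G) : wordDist A 1 (g⁻¹ * h) = wordDist A g h := by
  simp [wordDist]

theorem map_le_cofinite_of_le_wordDist {a : ℕ → G}
    (ha : ∀ n, n ≤ wordDist A 1 (a n)) :
    ((Filter.hyperfilter ℕ).map a : Filter G) ≤ Filter.cofinite := by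
  intro s hs
  obtain ⟨N, hN⟩ := ((Filter.mem_cofinite.1 hs).image (wordDist A 1)).bddAbove
  refine Filter.hyperfilter_le_cofinite (Filter.mem_cofinite.2 ?_)
  exact (Set.finite_Iic N).subset fun n hn => (ha n).trans (hN ⟨a n, hn, rfl⟩)

theorem finite_nearPoints (hgen : Subgroup.closure A = ⊤) (hA : A.Finite) {ε : ℕ}
    (hB : Bottleneck A ε) (h : IsNestedCutSystem A 𝓔)
    (hsep : ∀ U V : Ultrafilter G, (U : Filter G) ≤ Filter.cofinite →
      (V : Filter G) ≤ Filter.cofinite → (∃ C, Separates U V C) → ∃ C ∈ 𝓔, Separates U V C)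
    (hv : IsOrientation 𝓔 v) : (nearPoints A 𝓔 v).Finite := by
  by_contra hinf
  obtain ⟨R, hR⟩ := h.exists_diam_le
  obtain ⟨x, hx⟩ := nearPoints_nonempty hgen h hv
  have hy : ∀ n, ∃ y ∈ nearPoints A 𝓔 v, 2 * n ≤ wordDist A x y := by
    intro n
    by_contra! hn
    exact hinf ((finite_ball hgen hA x (2 * n)).subset fun y hy => (hn y hy).le)
  choose y hy hyn using hy
  have hz : ∀ n, ∃ z, wordDist A x z = n ∧ wordDist A z (y n) = wordDist A x (y n) - n :=
    fun n => exists_at_wordDist hgen (by have := hyn n; lia)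
  choose z hz1 hz2 using hz
  let F : Set (Set (Set G)) := ⋃ w ∈ {w | wordDist A 1 w ≤ R},
    (w • ·) '' {v | IsOrientation 𝓔 v ∧ 1 ∈ nearPoints A 𝓔 v}
  have hF : F.Finite :=
    (finite_ball hgen hA 1 R).biUnion fun w _ => (finite_one_mem_nearPoints h hA).image _
  have hzF : ∀ n, (z n)⁻¹ • v ∈ F := by
    intro n
    obtain ⟨p, hp, hpR⟩ := exists_nearPoint_wordDist_le hgen h hR hv hx (hy n) (z := z n)
      (by have := hz1 n; have := hz2 n; have := hyn n; lia)
    refine Set.mem_biUnion (x := (z n)⁻¹ * p) ?_ ⟨p⁻¹ • v, ⟨hv.smul h _, ?_⟩, ?_⟩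
    · rwa [Set.mem_ofPred_eq, wordDist_one_inv_mul]
    · simpa using mul_mem_nearPoints h hp p⁻¹
    · simp [smul_smul]
  let ω : Ultrafilter ℕ := Filter.hyperfilter ℕ
  obtain ⟨q, hqF, hq⟩ : ∃ q ∈ F, (fun n => (z n)⁻¹ • v) ⁻¹' {q} ∈ ω := by
    refine (Ultrafilter.finite_biUnion_mem_iff hF).1 (Filter.mem_of_superset Filter.univ_mem ?_)
    exact fun n _ => Set.mem_biUnion (hzF n) rfl
  have hqo : IsOrientation 𝓔 q := by
    obtain ⟨n, hn⟩ := ω.nonempty_of_mem hq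
    rw [← show (z n)⁻¹ • v = q from hn]
    exact hv.smul h _
  let a : ℕ → G := fun n => (z n)⁻¹ * x
  let b : ℕ → G := fun n => (z n)⁻¹ * y n
  have haU : (ω.map a : Filter G) ≤ Filter.cofinite :=
    map_le_cofinite_of_le_wordDist fun n => by
    rw [wordDist_one_inv_mul, wordDist_comm hgen, hz1]
  have hbV : (ω.map b : Filter G) ≤ Filter.cofinite :=
    map_le_cofinite_of_le_wordDist fun n => by
    rw [wordDist_one_inv_mul, hz2]; have := hyn n; lia
  have hqU : nearPoints A 𝓔 q ∈ ω.map a := Filter.mem_of_superset (y := a ⁻¹' _) hq fun n hn => by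
    rw [← show (z n)⁻¹ • v = q from hn]
    exact mul_mem_nearPoints h hx _
  have hqV : nearPoints A 𝓔 q ∈ ω.map b := Filter.mem_of_superset (y := b ⁻¹' _) hq fun n hn => by
    rw [← show (z n)⁻¹ • v = q from hn]
    exact mul_mem_nearPoints h (hy n) _
  have hN := finite_ball hgen hA 1 ε
  obtain ⟨c, hc, hcU⟩ := exists_component_mem hgen hA hN haU
  have hcV : component A {w | wordDist A 1 w ≤ ε}ᶜ c ∈ ω.map b := by
    by_contra hcV
    obtain ⟨C, hC, hCsep⟩ := hsep _ _ haU hbV ⟨_, thin_component hgen hN hc, hcU, hcV⟩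
    exact not_separates_of_nearPoints_mem h hqo haU hbV hqU hqV hC hCsep
  obtain ⟨n, hna, hnb⟩ := ω.nonempty_of_mem (Filter.inter_mem hcU hcV)
  obtain ⟨p, hp, hp1⟩ := hB _ (a n) (b n) 1 (cayleyConnected_component _ _) hna hnb (by
    rw [wordDist_comm hgen (a n), wordDist_one_inv_mul, wordDist_one_inv_mul]
    simp only [a, b, wordDist_mul_left]
    have := hz1 n; have := hz2 n; have := hyn n
    rw [wordDist_comm hgen (z n)]
    lia)
  exact component_subset hc hp hp1

/-- The stabilizers of the orientations have orders dividing a common positive number. -/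
theorem exists_card_stabilizer_dvd (hgen : Subgroup.closure A = ⊤) (hA : A.Finite)
    (h : IsNestedCutSystem A 𝓔) (hfin : ∀ v, IsOrientation 𝓔 v → (nearPoints A 𝓔 v).Finite) :
    ∃ n, 0 < n ∧ ∀ v : orientations h, Nat.card (MulAction.stabilizer G v) ∣ n := by
  classical
  have hstab : ∀ v : orientations h, Finite (MulAction.stabilizer G v) := by
    intro v
    obtain ⟨y, hy⟩ := nearPoints_nonempty hgen h v.2
    have := (hfin v v.2).to_subtype
    refine Finite.of_injective (β := nearPoints A 𝓔 v)
      (fun g : MulAction.stabilizer G v => ⟨g * y, ?_⟩) fun g g' hgg => ?_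
    · have := mul_mem_nearPoints h hy (g : G)
      have h2 : (g : G) • (v : Set (Set G)) = v := congrArg Subtype.val g.2
      rwa [h2] at this
    · exact Subtype.ext (mul_right_cancel (congrArg Subtype.val hgg))
  have hF : {v : orientations h | 1 ∈ nearPoints A 𝓔 v}.Finite :=
    ((finite_one_mem_nearPoints h hA).preimage Subtype.val_injective.injOn).subset
      fun v hv => ⟨v.2, hv⟩
  refine ⟨∏ v ∈ hF.toFinset, Nat.card (MulAction.stabilizer G v),
    Finset.prod_pos fun v _ => Nat.card_pos, fun v => ?_⟩
  obtain ⟨y, hy⟩ := nearPoints_nonempty hgen h v.2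
  have h1 : y⁻¹ • v ∈ hF.toFinset := by
    simpa using mul_mem_nearPoints h hy y⁻¹
  rw [Nat.card_congr (MulAction.stabilizerEquivStabilizer (g := y⁻¹) (a := v) rfl).toEquiv]
  exact Finset.dvd_prod_of_mem (fun v => Nat.card (MulAction.stabilizer G v)) h1

/-- A finitely generated group whose Cayley graph has bottlenecks is virtually free. -/
theorem Bottleneck.virtuallyFree (hgen : Subgroup.closure A = ⊤) (hA : A.Finite) {ε : ℕ}
    (hB : Bottleneck A ε) : VirtuallyFree G := by
  obtain ⟨𝓔, h, hsep⟩ := exists_isNestedCutSystem hgen hA hB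
  obtain ⟨T, hT⟩ := exists_orientationTree h
  obtain ⟨n, hn, hstab⟩ := exists_card_stabilizer_dvd hgen hA h fun v hv =>
    finite_nearPoints hgen hA hB h hsep hv
  exact T.virtuallyFree hT hn hstab

end Stabilizers

section FreeGroupMedians

variable {S : Type*} [DecidableEq S]

namespace FreeGroup

/-- `q` lies on the path from `a` to `b` in the Cayley tree of the free group: the geodesics from
`q` to `a` and `b` do not have a common first edge. -/
def Between (q a b : FreeGroup S) : Prop :=
  ∀ l ∈ (q⁻¹ * a).toWord.head?, l ∉ (q⁻¹ * b).toWord.head?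

theorem Between.or {q a b : FreeGroup S} (h : Between q a b) (c : FreeGroup S) :
    Between q a c ∨ Between q c b := by
  by_contra! hc
  simp only [Between, not_forall, not_not] at hc
  obtain ⟨⟨l, hl, hl'⟩, k, hk, hk'⟩ := hc
  rw [Option.mem_unique hk hl'] at hk'
  exact h l hl hk'

theorem Between.exists_step {q : FreeGroup S} {x : ℕ → FreeGroup S} {m : ℕ}
    (h : Between q (x 0) (x m)) : q = x 0 ∨ ∃ j < m, Between q (x j) (x (j + 1)) := by
  induction m with
  | zero =>
    left
    have h1 : (q⁻¹ * x 0).toWord.head? = none := Option.eq_none_iff_forall_not_mem.2 fun l hl =>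
      h l hl hl
    rwa [List.head?_eq_none_iff, toWord_eq_nil_iff, inv_mul_eq_one] at h1
  | succ m ih =>
    rcases h.or (x m) with h | h
    · obtain h | ⟨j, hj, h⟩ := ih h
      · exact Or.inl h
      · exact Or.inr ⟨j, hj.trans m.lt_succ_self, h⟩
    · exact Or.inr ⟨m, m.lt_succ_self, h⟩

theorem toWord_mul_of_between {u w : FreeGroup S} (h : Between u 1 w) :
    w.toWord = u.toWord ++ (u⁻¹ * w).toWord := by
  have hred : IsReduced (u.toWord ++ (u⁻¹ * w).toWord) := by
    refine List.isChain_append.2 ⟨isReduced_toWord, isReduced_toWord, fun x hx y hy hxy => ?_⟩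
    by_contra hne
    refine h y ?_ hy
    rw [mul_one, toWord_inv, invRev, List.head?_reverse, List.getLast?_map, Option.mem_def.1 hx]
    simp only [Option.map_some, Option.mem_def, Option.some.injEq]
    exact Prod.ext hxy (Bool.not_eq.2 hne)
  have h1 := toWord_mul u (u⁻¹ * w)
  rwa [mul_inv_cancel_left, hred.reduce_eq] at h1

theorem finite_between_one (w : FreeGroup S) : {u | Between u 1 w}.Finite := by
  refine Set.Finite.of_finite_image (f := toWord) ?_ toWord_injective.injOn
  refine (List.finite_toSet w.toWord.inits).subset ?_
  rintro _ ⟨u, hu, rfl⟩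
  exact (List.mem_inits _ _).2 ⟨_, (toWord_mul_of_between hu).symm⟩

theorem between_mul_left {p q a b : FreeGroup S} :
    Between (p * q) (p * a) (p * b) ↔ Between q a b := by
  simp [Between, mul_assoc]

/-- Any three elements of a free group have a median. -/
theorem exists_median (a b c : FreeGroup S) :
    ∃ q, Between q a b ∧ Between q b c ∧ Between q a c := by
  have hstep : ∀ (l : S × Bool) (x : FreeGroup S), ((mk [l])⁻¹ * x).norm ≤ x.norm + 1 :=
    fun l x => (norm_mul_le _ _).trans (by
      have := norm_mk_le (L₁ := [l])
      rw [norm_inv_eq, List.length_singleton] at *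
      lia)
  have hdown : ∀ (l : S × Bool) (x : FreeGroup S), l ∈ x.toWord.head? →
      ((mk [l])⁻¹ * x).norm + 1 ≤ x.norm := by
    intro l x hl
    obtain ⟨L, hL⟩ : ∃ L, x.toWord = l :: L := ⟨_, List.eq_cons_of_mem_head? hl⟩
    have hx : x = mk [l] * mk L := by rw [mul_mk, List.singleton_append, ← hL, mk_toWord]
    have h1 : x.norm = L.length + 1 := by rw [norm, hL, List.length_cons]
    rw [h1, hx, inv_mul_cancel_left]
    have := norm_mk_le (L₁ := L)
    lia
  have key : ∀ (x y z : FreeGroup S), ¬ Between 1 x y → ∃ g : FreeGroup S,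
      (g⁻¹ * x).norm + (g⁻¹ * y).norm + (g⁻¹ * z).norm < x.norm + y.norm + z.norm := by
    intro x y z h
    simp only [Between, not_forall, not_not, inv_one, one_mul] at h
    obtain ⟨l, hx, hy⟩ := h
    refine ⟨mk [l], ?_⟩
    have h1 := hdown l x hx
    have h2 := hdown l y hy
    have h3 := hstep l z
    lia
  let N : FreeGroup S → ℕ := fun q => (q⁻¹ * a).norm + (q⁻¹ * b).norm + (q⁻¹ * c).norm
  obtain ⟨q, hq⟩ : ∃ q, ∀ q', N q ≤ N q' :=
    ⟨Function.argmin N, fun q' => Function.argmin_le N q'⟩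
  have htr : ∀ x y, Between q x y ↔ Between 1 (q⁻¹ * x) (q⁻¹ * y) := fun x y => by simp [Between]
  have hmul : ∀ g x, g⁻¹ * (q⁻¹ * x) = (q * g)⁻¹ * x := fun g x => by group
  refine ⟨q, ?_, ?_, ?_⟩
  all_goals
    rw [htr]
    by_contra h
  · obtain ⟨g, hg⟩ := key _ _ (q⁻¹ * c) h
    have := hq (q * g)
    simp only [hmul, N] at *
    lia
  · obtain ⟨g, hg⟩ := key _ _ (q⁻¹ * a) h
    have := hq (q * g)
    simp only [hmul, N] at *
    lia
  · obtain ⟨g, hg⟩ := key _ _ (q⁻¹ * b) h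
    have := hq (q * g)
    simp only [hmul, N] at *
    lia

end FreeGroup

end FreeGroupMedians

section VirtuallyFreeGroups

variable {G : Type*} [Group G] {A : Set G}

/-- A subgroup of finite index is within bounded distance of the whole group. -/
theorem Subgroup.exists_retraction (H : Subgroup G) [H.FiniteIndex] :
    ∃ (T : Set G) (r : G → H), T.Finite ∧ ∀ g, (r g : G)⁻¹ * g ∈ T := by
  refine ⟨Set.range fun x : G ⧸ H => x.out⁻¹,
    fun g => ⟨g * ((g⁻¹ : G) : G ⧸ H).out, ?_⟩, Set.finite_range _, fun g => ?_⟩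
  · have : (((g⁻¹ : G) : G ⧸ H).out : G ⧸ H) = ((g⁻¹ : G) : G ⧸ H) := QuotientGroup.out_eq' _
    have := QuotientGroup.eq.1 this.symm
    rwa [inv_inv] at this
  · exact ⟨((g⁻¹ : G) : G ⧸ H), by simp⟩

open FreeGroup in
/-- A virtually free group has a coarse projection to a free group such that paths pass near the
points between the projections of their endpoints. -/
theorem VirtuallyFree.exists_projection.{u} {G : Type u} [Group G] {A : Set G}
    (hgen : Subgroup.closure A = ⊤) (hA : A.Finite)
    (hG : VirtuallyFree G) : ∃ (S : Type u) (_ : DecidableEq S) (f : G → FreeGroup S)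
      (k : FreeGroup S → G) (K : ℕ), ∀ (γ : ℕ → G) (m : ℕ), IsDiscPath A γ m →
        ∀ q, Between q (f (γ 0)) (f (γ m)) → ∃ j ≤ m, wordDist A (γ j) (k q) ≤ K := by
  classical
  obtain ⟨H, hH, hfree⟩ := hG
  obtain ⟨T, r, hT, hr⟩ := H.exists_retraction
  let e := IsFreeGroup.toFreeGroup H
  let W : Set (FreeGroup (IsFreeGroup.Generators H)) :=
    {w | ((e.symm w : H) : G) ∈ T * {h | wordDist A 1 h ≤ 1} * T⁻¹}
  have hW : W.Finite := ((hT.mul (finite_ball hgen hA 1 1)).mul hT.inv).preimage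
    (Subtype.val_injective.comp e.symm.injective).injOn
  let U : Set (FreeGroup (IsFreeGroup.Generators H)) := insert 1 (⋃ w ∈ W, {u | Between u 1 w})
  have hU : U.Finite := (hW.biUnion fun w _ => finite_between_one w).insert 1
  have hZ : (T⁻¹ * (fun u => ((e.symm u : H) : G)) '' U).Finite := hT.inv.mul (hU.image _)
  obtain ⟨K, hK⟩ := (hZ.image (wordDist A 1)).bddAbove
  have hnear : ∀ g q, (e (r g))⁻¹ * q ∈ U → wordDist A g (e.symm q : H) ≤ K := by
    intro g q hq
    rw [← wordDist_one_inv_mul]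
    refine hK ⟨_, Set.mul_mem_mul (Set.inv_mem_inv.2 (hr g)) ⟨_, hq, rfl⟩, ?_⟩
    congr 1
    simp [mul_assoc]
  refine ⟨_, inferInstance, fun g => e (r g), fun q => (e.symm q : H), K, fun γ m hγ q hq => ?_⟩
  obtain h | ⟨j, hj, h⟩ := Between.exists_step (x := fun j => e (r (γ j))) hq
  · exact ⟨0, m.zero_le, hnear _ _ (Or.inl (by rw [h, inv_mul_cancel]))⟩
  · refine ⟨j, hj.le, hnear _ _ (Or.inr (Set.mem_biUnion (x := (e (r (γ j)))⁻¹ * e (r (γ (j + 1))))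
      ?_ ?_))⟩
    · have h1 : (γ j)⁻¹ * γ (j + 1) ∈ {h | wordDist A 1 h ≤ 1} := by
        rw [Set.mem_ofPred_eq, wordDist_one_inv_mul]; exact hγ j hj
      have h2 := Set.mul_mem_mul (Set.mul_mem_mul (hr (γ j)) h1)
        (Set.inv_mem_inv.2 (hr (γ (j + 1))))
      change ((e.symm _ : H) : G) ∈ T * {h | wordDist A 1 h ≤ 1} * T⁻¹
      convert h2 using 1
      simp [mul_assoc]
    · rw [Set.mem_ofPred_eq, ← between_mul_left (p := e (r (γ j)))]
      simpa using h

theorem IsDiscGeodesic.isDiscPath {γ : ℕ → G} {m : ℕ} (hγ : IsDiscGeodesic A γ m) :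
    IsDiscPath A γ m := fun i hi => by
  rw [hγ.wordDist_eq i.le_succ hi]; lia

/-- In a virtually free group, geodesics stay close to paths with the same endpoints. -/
theorem VirtuallyFree.exists_near_paths (hgen : Subgroup.closure A = ⊤) (hA : A.Finite)
    (hG : VirtuallyFree G) : ∃ K : ℕ, ∀ (γ γ' : ℕ → G) (m m' : ℕ), IsDiscGeodesic A γ m →
      IsDiscPath A γ' m' → γ' 0 = γ 0 → γ' m' = γ m → ∀ i ≤ m, ∃ j ≤ m',
        wordDist A (γ i) (γ' j) ≤ K := by
  obtain ⟨S, _, f, k, K, hK⟩ := hG.exists_projection hgen hA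
  refine ⟨4 * K, fun γ γ' m m' hγ hγ' h0 hm i hi => ?_⟩
  obtain ⟨q, hq1, hq2, hq3⟩ := FreeGroup.exists_median (f (γ 0)) (f (γ i)) (f (γ m))
  have hp := hγ.isDiscPath
  obtain ⟨a, ha, had⟩ := hK γ i (fun j hj => hp j (hj.trans_le hi)) q hq1
  obtain ⟨b, hb, hbd⟩ := hK (fun j => γ (i + j)) (m - i) (fun j hj => hp (i + j) (by lia)) q (by
    simpa [Nat.add_sub_cancel' hi] using hq2)
  obtain ⟨j, hj, hjd⟩ := hK γ' m' hγ' q (by rwa [h0, hm])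
  refine ⟨j, hj, ?_⟩
  have h1 := hγ.wordDist_eq ha hi
  have h2 := hγ.wordDist_eq (i := a) (j := i + b) (by lia) (by lia)
  have h3 := wordDist_triangle hgen (γ a) (k q) (γ (i + b))
  have h4 := wordDist_triangle hgen (γ i) (γ a) (k q)
  have h5 := wordDist_triangle hgen (γ i) (k q) (γ' j)
  rw [wordDist_comm hgen (k q)] at h3 h5
  rw [wordDist_comm hgen (γ i) (γ a)] at h4
  lia

end VirtuallyFreeGroups

/-- A group `G` generated by a finite set `A` is virtually free if and only if there
exists `ε ≥ 0` such that for every discrete geodesic `γ` from `g` to `h` and every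
discrete path `γ'` from `g` to `h`, every vertex of `γ` is within word-metric
distance `ε` of some vertex of `γ'`. -/
theorem virtuallyFree_iff_geodesics_near_paths {G : Type*} [Group G]
    (A : Set G) (hA : A.Finite) (hgen : Subgroup.closure A = ⊤) :
    VirtuallyFree G ↔
      ∃ ε : ℝ, 0 ≤ ε ∧ ∀ (g h : G) (γ γ' : ℕ → G) (m m' : ℕ),
        IsDiscGeodesic A γ m → IsDiscPath A γ' m' →
        γ 0 = g → γ m = h → γ' 0 = g → γ' m' = h →
        ∀ i ≤ m, ∃ j ≤ m', (wordDist A (γ i) (γ' j) : ℝ) ≤ ε := by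
  constructor
  · intro hG
    obtain ⟨K, hK⟩ := hG.exists_near_paths hgen hA
    refine ⟨K, K.cast_nonneg, ?_⟩
    rintro g h γ γ' m m' hγ hγ' rfl rfl h0 hm i hi
    obtain ⟨j, hj, hd⟩ := hK γ γ' m m' hγ hγ' h0 hm i hi
    exact ⟨j, hj, Nat.cast_le.2 hd⟩
  · rintro ⟨ε, -, H⟩
    exact (bottleneck_of_geodesics_near_paths hgen H).virtuallyFree hgen hA
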